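/- As min{m,n} → ∞, the expected number of regions in the random pattern H_{1/2}(m,n) satisfies E[Regions(H_{1/2}(m,n))] = ((π² − 9)/12 + o(1))·mn. -/

import Mathlib

/-- A stitch is a unit segment of the grid: `vert i j` is the vertical segment from
`(i,j)` to `(i,j+1)`; `horiz i j` is the horizontal segment from `(i,j)` to `(i+1,j)`. -/
inductive Stitch : Type
  | vert : ℤ → ℤ → Stitch
  | horiz : ℤ → ℤ → Stitch
  deriving DecidableEq

/-- Membership of a stitch in the hitomezashi pattern with labels `ε` (vertical lines)
and `η` (horizontal lines). -/
def Stitch.InPattern (ε η : ℤ → ZMod 2) : Stitch → Prop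
  | .vert i j => (j : ZMod 2) = ε i
  | .horiz i j => (i : ZMod 2) = η j

/-- The stitch as a subset of the plane. -/
def Stitch.seg : Stitch → Set (ℝ × ℝ)
  | .vert i j => segment ℝ ((i : ℝ), (j : ℝ)) ((i : ℝ), (j : ℝ) + 1)
  | .horiz i j => segment ℝ ((i : ℝ), (j : ℝ)) ((i : ℝ) + 1, (j : ℝ))

/-- The union of the segments of a set of stitches. -/
def curveOf (S : Set Stitch) : Set (ℝ × ℝ) := ⋃ s ∈ S, s.seg

/-- `C` is a simple closed curve: it is homeomorphic to a circle. -/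
def IsCircle (C : Set (ℝ × ℝ)) : Prop :=
  Nonempty (C ≃ₜ Metric.sphere (0 : ℝ × ℝ) 1)

/-- The interior of a closed curve `C`: the union of the bounded connected
components of its complement. -/
def intOf (C : Set (ℝ × ℝ)) : Set (ℝ × ℝ) :=
  {p | p ∉ C ∧ Bornology.IsBounded (connectedComponentIn Cᶜ p)}

/-- The exterior of a closed curve `C`: the union of the unbounded connected
components of its complement. -/
def extOf (C : Set (ℝ × ℝ)) : Set (ℝ × ℝ) :=
  {p | p ∉ C ∧ ¬ Bornology.IsBounded (connectedComponentIn Cᶜ p)}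

/-- The open unit cell with southwest corner `(i,j)`. -/
def cell (i j : ℤ) : Set (ℝ × ℝ) :=
  Set.Ioo (i : ℝ) ((i : ℝ) + 1) ×ˢ Set.Ioo (j : ℝ) ((j : ℝ) + 1)

/-- A hitomezashi loop in the pattern with labels `ε`, `η`: a (finite) set of stitches
of the pattern whose union is a simple closed curve. -/
structure HLoop (ε η : ℤ → ZMod 2) where
  stitches : Finset Stitch
  inPattern : ∀ s ∈ stitches, s.InPattern ε η
  isCircle : IsCircle (curveOf ↑stitches)

/-- The stitch lies inside the `m × n` grid `[0,n] × [0,m]`. -/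
def Stitch.inGrid (m n : ℕ) : Stitch → Prop
  | .vert i j => 0 ≤ i ∧ i ≤ (n : ℤ) ∧ 0 ≤ j ∧ j + 1 ≤ (m : ℤ)
  | .horiz i j => 0 ≤ i ∧ i + 1 ≤ (n : ℤ) ∧ 0 ≤ j ∧ j ≤ (m : ℤ)

/-- The number of hitomezashi loops all of whose stitches are stitches of the
`m × n` hitomezashi pattern with labels `ε`, `η`. -/
noncomputable def LoopsCount (m n : ℕ) (ε η : ℤ → ZMod 2) : ℕ :=
  Nat.card {S : Finset Stitch // IsCircle (curveOf ↑S) ∧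
    ∀ s ∈ S, s.InPattern ε η ∧ s.inGrid m n}

/-- Extend labels on `{0, …, N}` to all of `ℤ` (by `0` outside; only the values on
`{0, …, N}` are relevant for stitches inside the grid). -/
def extendLabels (N : ℕ) (f : Fin (N+1) → ZMod 2) : ℤ → ZMod 2 :=
  fun i => if h : 0 ≤ i ∧ i ≤ (N : ℤ) then f ⟨i.toNat, by omega⟩ else 0

/-- The expected number of loops in the random `m × n` hitomezashi pattern whose
`m + n + 2` labels are independent and uniform on `{0,1}`. -/
noncomputable def ELoops (m n : ℕ) : ℝ :=
  (∑ f : Fin (n+1) → ZMod 2, ∑ g : Fin (m+1) → ZMod 2,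
    (LoopsCount m n (extendLabels n f) (extendLabels m g) : ℝ)) / 2 ^ (m + n + 2)

/-- The number of connected components into which the stitches of the `m × n` hitomezashi
pattern with labels `ε`, `η` divide the rectangle `[0,n] × [0,m]`. -/
noncomputable def RegionsCount (m n : ℕ) (ε η : ℤ → ZMod 2) : ℕ :=
  Nat.card {C : Set (ℝ × ℝ) //
    ∃ p ∈ (Set.Icc (0:ℝ) (n:ℝ) ×ˢ Set.Icc (0:ℝ) (m:ℝ)) \
        curveOf {s : Stitch | s.InPattern ε η ∧ s.inGrid m n},
      C = connectedComponentIn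
        ((Set.Icc (0:ℝ) (n:ℝ) ×ˢ Set.Icc (0:ℝ) (m:ℝ)) \
          curveOf {s : Stitch | s.InPattern ε η ∧ s.inGrid m n}) p}

/-- The expected number of regions of the random `m × n` hitomezashi pattern whose
`m + n + 2` labels are independent and uniform on `{0,1}`. -/
noncomputable def ERegions (m n : ℕ) : ℝ :=
  (∑ f : Fin (n+1) → ZMod 2, ∑ g : Fin (m+1) → ZMod 2,
    (RegionsCount m n (extendLabels n f) (extendLabels m g) : ℝ)) / 2 ^ (m + n + 2)

/-- The cells of the `m × n` grid, indexed by their southwest corners. -/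
def gridBox (m n : ℕ) : Set (ℤ × ℤ) := {p | 0 ≤ p.1 ∧ p.1 < n ∧ 0 ≤ p.2 ∧ p.2 < m}

/-- `q` is the right or the upper neighbour of `p`. -/
def StepTo (p q : ℤ × ℤ) : Prop := q = (p.1 + 1, p.2) ∨ q = (p.1, p.2 + 1)

/-- Neighbouring cells that both belong to `S`. -/
def LinkIn (S : Set (ℤ × ℤ)) (p q : ℤ × ℤ) : Prop := p ∈ S ∧ q ∈ S ∧ StepTo p q

/-- Neighbouring cells of the grid at the same level `⌊(X + Y) / 2⌋`. -/
def LevelLink (m n : ℕ) (X Y : ℤ → ℤ) (p q : ℤ × ℤ) : Prop :=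
  p ∈ gridBox m n ∧ q ∈ gridBox m n ∧ (X p.1 + Y p.2) / 2 = (X q.1 + Y q.2) / 2 ∧ StepTo p q

/-- A sequence whose increments are `1` or `-1`. -/
def IsWalk (X : ℤ → ℤ) : Prop := ∀ i, X (i + 1) = X i + 1 ∨ X (i + 1) = X i - 1

/-- `X` makes an excursion of height exactly `h` above `X a` on the interval `[a, b]`. -/
def IsExc (X : ℤ → ℤ) (a b h : ℤ) : Prop :=
  a < b ∧ X b = X a ∧ (∀ i, a < i → i < b → X a < X i ∧ X i ≤ X a + h) ∧
    ∃ i, a < i ∧ i < b ∧ X i = X a + h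

/-- The cells of the grid at which `X + Y` is at least `t`. -/
def upperSet (m n : ℕ) (X Y : ℤ → ℤ) (t : ℤ) : Set (ℤ × ℤ) :=
  {p | p ∈ gridBox m n ∧ t ≤ X p.1 + Y p.2}

/-- `U` is a connected component of the set of cells at which `X + Y` is at least `t`. -/
structure IsComp (X Y : ℤ → ℤ) (t : ℤ) (U : Set (ℤ × ℤ)) : Prop where
  le : ∀ i j, (i, j) ∈ U → t ≤ X i + Y j
  right : ∀ i j, (i, j) ∈ U → t ≤ X (i + 1) + Y j → (i + 1, j) ∈ U
  left : ∀ i j, (i, j) ∈ U → t ≤ X (i - 1) + Y j → (i - 1, j) ∈ U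
  up : ∀ i j, (i, j) ∈ U → t ≤ X i + Y (j + 1) → (i, j + 1) ∈ U
  down : ∀ i j, (i, j) ∈ U → t ≤ X i + Y (j - 1) → (i, j - 1) ∈ U
  ind : ∀ P : ℤ → ℤ → Prop, (∃ i j, (i, j) ∈ U ∧ P i j) →
    (∀ i j, (i, j) ∈ U → (i + 1, j) ∈ U → (P i j ↔ P (i + 1) j)) →
    (∀ i j, (i, j) ∈ U → (i, j + 1) ∈ U → (P i j ↔ P i (j + 1))) →
    ∀ i j, (i, j) ∈ U → P i j

theorem IsComp.swap {X Y : ℤ → ℤ} {t : ℤ} {U : Set (ℤ × ℤ)} (h : IsComp X Y t U) :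
    IsComp Y X t {p | (p.2, p.1) ∈ U} where
  le i j hp := by have := h.le j i hp; omega
  right i j hp ht := h.up j i hp (by omega)
  left i j hp ht := h.down j i hp (by omega)
  up i j hp ht := h.right j i hp (by omega)
  down i j hp ht := h.left j i hp (by omega)
  ind P := by
    rintro ⟨i, j, hp, hP⟩ h1 h2 i' j' hp'
    exact h.ind (fun a b => P b a) ⟨j, i, hp, hP⟩ (fun a b ha hb => h2 b a ha hb)
      (fun a b ha hb => h1 b a ha hb) j' i' hp'

theorem IsComp.reflect {X Y : ℤ → ℤ} {t : ℤ} {U : Set (ℤ × ℤ)} (h : IsComp X Y t U) :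
    IsComp (fun i => X (-i)) Y t {p | (-p.1, p.2) ∈ U} where
  le i j hp := h.le (-i) j hp
  right i j hp ht := by
    have e : -(i + 1) = -i - 1 := by ring
    simp only [Set.mem_ofPred_eq, e] at *
    exact h.left _ j hp ht
  left i j hp ht := by
    have e : -(i - 1) = -i + 1 := by ring
    simp only [Set.mem_ofPred_eq, e] at *
    exact h.right _ j hp ht
  up i j hp ht := h.up (-i) j hp ht
  down i j hp ht := h.down (-i) j hp ht
  ind P := by
    rintro ⟨i, j, hp, hP⟩ h1 h2 i' j' hp'
    have := h.ind (fun a b => P (-a) b) ⟨-i, j, hp, by simpa using hP⟩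
      (fun a b ha hb => ?_) (fun a b ha hb => h2 (-a) b (by simpa using ha) (by simpa using hb))
      (-i') j' hp'
    · simpa using this
    · have := h1 (-(a + 1)) b (by simpa using hb) (by
        have e : -(-(a + 1) + 1) = a := by ring
        simpa only [Set.mem_ofPred_eq, e] using ha)
      have e : -(a + 1) + 1 = -a := by ring
      rw [e] at this
      exact this.symm

theorem IsWalk.reflect {X : ℤ → ℤ} (hX : IsWalk X) : IsWalk (fun i => X (-i)) := by
  intro i
  have := hX (-(i + 1))
  have e : -(i + 1) + 1 = -i := by ring
  rw [e] at this
  simp only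
  omega

theorem IsWalk.pred {X : ℤ → ℤ} (hX : IsWalk X) (i : ℤ) :
    X (i - 1) = X i + 1 ∨ X (i - 1) = X i - 1 := by
  have := hX (i - 1)
  rw [sub_add_cancel] at this
  omega

theorem IsComp.left_end {X Y : ℤ → ℤ} {t : ℤ} {U : Set (ℤ × ℤ)} (h : IsComp X Y t U)
    (hX : IsWalk X) {a j : ℤ} (haj : (a, j) ∈ U) (hmin : ∀ i k, (i, k) ∈ U → a ≤ i) :
    X (a - 1) = X a - 1 ∧ X a + Y j = t ∧ ∀ i k, (i, k) ∈ U → Y k ≤ Y j ∧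
      ∀ i', a ≤ i' → i' ≤ i → X a ≤ X i' ∧ ∃ k', (i', k') ∈ U := by
  have h1 := h.le _ _ haj
  have h2 : ¬ t ≤ X (a - 1) + Y j := fun h2 => by
    have := hmin _ _ (h.left _ _ haj h2); omega
  have h3 := hX.pred a
  have ht : X a + Y j = t := by omega
  refine ⟨by omega, ht, ?_⟩
  have key : ∀ i k, (i, k) ∈ U → (∀ i', a ≤ i' → i' ≤ i → X a ≤ X i') → Y k ≤ Y j := by
    intro i k hik hx
    by_contra hlt
    have row : ∀ d : ℕ, a - 1 ≤ i - d → (i - d, k) ∈ U := by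
      intro d
      induction d with
      | zero => intro _; simpa using hik
      | succ d ih =>
        intro hd
        push_cast at hd ⊢
        have := h.left _ _ (ih (by omega))
        rw [← sub_sub]
        apply this
        by_cases hc : a ≤ i - d - 1
        · have := hx (i - d - 1) hc (by omega)
          omega
        · have : i - d - 1 = a - 1 := by omega
          rw [this]
          omega
    have hai := hmin _ _ hik
    have := row (i - (a - 1)).toNat (by omega)
    have := hmin _ _ this
    omega
  refine h.ind (fun i k => Y k ≤ Y j ∧
      ∀ i', a ≤ i' → i' ≤ i → X a ≤ X i' ∧ ∃ k', (i', k') ∈ U) ⟨a, j, haj, le_rfl, ?_⟩ ?_ ?_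
  · intro i' hi hi'
    obtain rfl : i' = a := by omega
    exact ⟨le_rfl, j, haj⟩
  · intro i k hi hi1
    refine and_congr_right fun hk => ⟨fun H i' h1 h2 => ?_, fun H i' h1 h2 => H i' h1 (by omega)⟩
    rcases (show i' ≤ i ∨ i' = i + 1 by omega) with h3 | rfl
    · exact H i' h1 h3
    · have := h.le _ _ hi1
      exact ⟨by omega, k, hi1⟩
  · intro i k hi hi1
    refine and_congr_left fun H => ⟨fun _ => ?_, fun _ => ?_⟩
    · exact key _ _ hi1 fun i' h1 h2 => (H i' h1 h2).1
    · exact key _ _ hi fun i' h1 h2 => (H i' h1 h2).1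

theorem IsComp.right_end {X Y : ℤ → ℤ} {t : ℤ} {U : Set (ℤ × ℤ)} (h : IsComp X Y t U)
    (hX : IsWalk X) {b j : ℤ} (hbj : (b, j) ∈ U) (hmax : ∀ i k, (i, k) ∈ U → i ≤ b) :
    X (b + 1) = X b - 1 ∧ X b + Y j = t ∧ ∀ i k, (i, k) ∈ U → Y k ≤ Y j := by
  obtain ⟨h1, h2, h3⟩ := h.reflect.left_end hX.reflect (a := -b) (j := j) (by simpa using hbj)
    (fun i k hik => by have := hmax _ _ hik; omega)
  have e : -(-b - 1) = b + 1 := by ring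
  simp only [e, neg_neg] at h1 h2
  exact ⟨h1, h2, fun i k hik => (h3 (-i) k (by simpa using hik)).1⟩

/-- A finite component is spanned by a pair of excursions of equal heights. -/
theorem IsComp.exists_isExc {X Y : ℤ → ℤ} {t : ℤ} {U : Set (ℤ × ℤ)} (h : IsComp X Y t U)
    (hX : IsWalk X) (hY : IsWalk Y) (hfin : U.Finite) (hne : U.Nonempty) :
    ∃ a b c d k, IsExc X a b k ∧ IsExc Y c d k ∧ t = X a + Y c + k + 1 ∧
      (∃ j, (a + 1, j) ∈ U) ∧ (∃ j, (b - 1, j) ∈ U) ∧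
      (∃ i, (i, c + 1) ∈ U) ∧ (∃ i, (i, d - 1) ∈ U) ∧
      (∀ i j, (i, j) ∈ U → a < i) ∧
      ∀ j, c < j → j < d → Y j = Y c + k → (a + 1, j) ∈ U := by
  obtain ⟨⟨a, ja⟩, haU, ha⟩ := Set.exists_min_image U Prod.fst hfin hne
  obtain ⟨⟨b, jb⟩, hbU, hb⟩ := Set.exists_max_image U Prod.fst hfin hne
  obtain ⟨⟨ic, c⟩, hcU, hc⟩ := Set.exists_min_image U Prod.snd hfin hne
  obtain ⟨⟨id, d⟩, hdU, hd⟩ := Set.exists_max_image U Prod.snd hfin hne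
  simp only [Prod.forall] at ha hb hc hd
  obtain ⟨a1, a2, a3⟩ := h.left_end hX haU ha
  obtain ⟨b1, b2, b3⟩ := h.right_end hX hbU hb
  obtain ⟨c1, c2, c3⟩ := h.swap.left_end hY (a := c) (j := ic) hcU (fun i k hk => hc k i hk)
  obtain ⟨d1, d2, d3⟩ := h.swap.right_end hY (b := d) (j := id) hdU (fun i k hk => hd k i hk)
  simp only [Set.mem_ofPred_eq] at c3 d3
  have hY1 := (a3 _ _ hbU).1
  have hY2 := b3 _ _ haU
  have hX1 := (c3 _ _ hdU).1
  have hX2 := d3 _ _ hcU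
  have hic1 := ha _ _ hcU
  have hic2 := hb _ _ hcU
  have hja1 := hc _ _ haU
  have hja2 := hd _ _ haU
  have hab := ha _ _ hbU
  have hcd := hc _ _ hdU
  have eX : IsExc X (a - 1) (b + 1) (X ic - X a + 1) := by
    refine ⟨by omega, by omega, fun i h1 h2 => ?_, ic, by omega, by omega, by omega⟩
    obtain ⟨h3, k, hk⟩ := (a3 _ _ hbU).2 i (by omega) (by omega)
    have := (c3 _ _ hk).1
    omega
  have eY : IsExc Y (c - 1) (d + 1) (X ic - X a + 1) := by
    refine ⟨by omega, by omega, fun j h1 h2 => ?_, ja, by omega, by omega, by omega⟩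
    obtain ⟨h3, k, hk⟩ := (c3 _ _ hdU).2 j (by omega) (by omega)
    have := (a3 _ _ hk).1
    omega
  refine ⟨a - 1, b + 1, c - 1, d + 1, X ic - X a + 1, eX, eY, by omega, ⟨ja, by simpa using haU⟩,
    ⟨jb, by simpa using hbU⟩, ⟨ic, by simpa using hcU⟩, ⟨id, by simpa using hdU⟩,
    fun i j hij => by have := ha _ _ hij; omega, fun j h1 h2 h3 => ?_⟩
  rw [sub_add_cancel]
  have col : ∀ e : ℕ, c + e ≤ d → (ic, c + e) ∈ U := by
    intro e
    induction e with
    | zero => intro _; simpa using hcU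
    | succ e ih =>
      intro he
      push_cast at he ⊢
      have h4 := (c3 _ _ hdU).2 (c + e + 1) (by omega) (by omega)
      have := h.up _ _ (ih (by omega)) (by omega)
      rwa [add_assoc] at this
  have hj := col (j - c).toNat (by omega)
  rw [show c + ((j - c).toNat : ℤ) = j by omega] at hj
  have row : ∀ e : ℕ, a ≤ ic - e → (ic - e, j) ∈ U := by
    intro e
    induction e with
    | zero => intro _; simpa using hj
    | succ e ih =>
      intro he
      push_cast at he ⊢
      have h4 := (a3 _ _ hcU).2 (ic - e - 1) (by omega) (by omega)
      have := h.left _ _ (ih (by omega)) (by omega)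
      rwa [sub_sub] at this
  have := row (ic - a).toNat (by omega)
  rwa [show ic - ((ic - a).toNat : ℤ) = a by omega] at this

theorem eqvGen_iff_of_forall {α : Type*} {r : α → α → Prop} {P : α → Prop}
    (h : ∀ x y, r x y → (P x ↔ P y)) {x y : α} (hxy : Relation.EqvGen r x y) : P x ↔ P y := by
  induction hxy with
  | rel x y hr => exact h x y hr
  | refl => rfl
  | symm _ _ _ ih => exact ih.symm
  | trans _ _ _ _ _ ih1 ih2 => exact ih1.trans ih2

theorem isComp_upper {m n : ℕ} {X Y : ℤ → ℤ} {t : ℤ} {p : ℤ × ℤ} {U : Set (ℤ × ℤ)}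
    (hp : p ∈ upperSet m n X Y t)
    (hU : U = {q | Relation.EqvGen (LinkIn (upperSet m n X Y t)) p q})
    (hbd : ∀ i j, (i, j) ∈ U → 0 < i ∧ i + 1 < n ∧ 0 < j ∧ j + 1 < m) :
    IsComp X Y t U := by
  have hUS : ∀ q, q ∈ U → q ∈ upperSet m n X Y t := by
    intro q hq
    rw [hU] at hq
    exact (eqvGen_iff_of_forall (P := fun q => q ∈ upperSet m n X Y t)
      (fun x y h => iff_of_true h.1 h.2.1) hq).1 hp
  have hpU : p ∈ U := by rw [hU]; exact .refl _
  have hlink : ∀ x y, LinkIn (upperSet m n X Y t) x y → (x ∈ U ↔ y ∈ U) := by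
    intro x y hxy
    rw [hU]
    exact ⟨fun h => .trans _ _ _ h (.rel _ _ hxy), fun h => .trans _ _ _ h (.symm _ _ (.rel _ _ hxy))⟩
  have hmem : ∀ i j : ℤ, 0 ≤ i → i < n → 0 ≤ j → j < m → t ≤ X i + Y j →
      (i, j) ∈ upperSet m n X Y t := fun i j h1 h2 h3 h4 h5 => ⟨⟨h1, h2, h3, h4⟩, h5⟩
  refine ⟨fun i j h => (hUS _ h).2, fun i j h ht => ?_, fun i j h ht => ?_, fun i j h ht => ?_,
    fun i j h ht => ?_, ?_⟩
  · have := hbd _ _ h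
    exact (hlink _ _ ⟨hUS _ h, hmem _ _ (by omega) (by omega) (by omega) (by omega) ht,
      Or.inl rfl⟩).1 h
  · have := hbd _ _ h
    exact (hlink _ _ ⟨hmem _ _ (by omega) (by omega) (by omega) (by omega) ht, hUS _ h,
      Or.inl (by simp)⟩).2 h
  · have := hbd _ _ h
    exact (hlink _ _ ⟨hUS _ h, hmem _ _ (by omega) (by omega) (by omega) (by omega) ht,
      Or.inr rfl⟩).1 h
  · have := hbd _ _ h
    exact (hlink _ _ ⟨hmem _ _ (by omega) (by omega) (by omega) (by omega) ht, hUS _ h,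
      Or.inr (by simp)⟩).2 h
  · rintro P ⟨i0, j0, h0, hP0⟩ h1 h2 i j hij
    have e0 := h0
    have e1 := hij
    rw [hU] at e0 e1
    have key := eqvGen_iff_of_forall (r := LinkIn (upperSet m n X Y t))
      (P := fun q => q ∈ U → P q.1 q.2) ?_ (.trans _ _ _ (.symm _ _ e0) e1)
    · exact key.1 (fun _ => hP0) hij
    · rintro ⟨x1, x2⟩ y hxy
      have hm := hlink _ _ hxy
      rcases hxy.2.2 with rfl | rfl
      · constructor
        · exact fun h hy => (h1 _ _ (hm.2 hy) hy).1 (h (hm.2 hy))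
        · exact fun h hx => (h1 _ _ hx (hm.1 hx)).2 (h (hm.1 hx))
      · constructor
        · exact fun h hy => (h2 _ _ (hm.2 hy) hy).1 (h (hm.2 hy))
        · exact fun h hx => (h2 _ _ hx (hm.1 hx)).2 (h (hm.1 hx))

open Classical in
/-- The flow from `p` to `q` across the part of the boundary of `C` below level `t`. -/
noncomputable def cutFlow (C : Set (ℤ × ℤ)) (F : ℤ × ℤ → ℤ) (t : ℤ) (p q : ℤ × ℤ) : ℤ :=
  (if q ∈ C ∧ F p < t then 1 else 0) - (if p ∈ C ∧ F q < t then 1 else 0)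

theorem cutFlow_closed {m n : ℕ} {X Y : ℤ → ℤ} (hX : IsWalk X) (hY : IsWalk Y)
    {C : Set (ℤ × ℤ)} {t : ℤ} (ht : t % 2 = 0)
    (hCt : ∀ p ∈ C, t ≤ X p.1 + Y p.2 ∧ X p.1 + Y p.2 ≤ t + 1)
    (hC : ∀ p q, LevelLink m n X Y p q → (p ∈ C ↔ q ∈ C)) {i j : ℤ}
    (h00 : (i, j) ∈ gridBox m n) (h11 : (i + 1, j + 1) ∈ gridBox m n) :
    cutFlow C (fun p => X p.1 + Y p.2) t (i, j) (i + 1, j) +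
      cutFlow C (fun p => X p.1 + Y p.2) t (i + 1, j) (i + 1, j + 1) =
    cutFlow C (fun p => X p.1 + Y p.2) t (i, j) (i, j + 1) +
      cutFlow C (fun p => X p.1 + Y p.2) t (i, j + 1) (i + 1, j + 1) := by
  have h10 : (i + 1, j) ∈ gridBox m n := ⟨h11.1, h11.2.1, h00.2.2.1, h00.2.2.2⟩
  have h01 : (i, j + 1) ∈ gridBox m n := ⟨h00.1, h00.2.1, h11.2.2.1, h11.2.2.2⟩
  have a1 := fun h => hC _ _ ⟨h00, h10, h, Or.inl rfl⟩
  have a2 := fun h => hC _ _ ⟨h00, h01, h, Or.inr rfl⟩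
  have a3 := fun h => hC _ _ ⟨h10, h11, h, Or.inr rfl⟩
  have a4 := fun h => hC _ _ ⟨h01, h11, h, Or.inl rfl⟩
  have b1 := hCt (i, j)
  have b2 := hCt (i + 1, j)
  have b3 := hCt (i, j + 1)
  have b4 := hCt (i + 1, j + 1)
  have x1 := hX i
  have y1 := hY j
  simp only [cutFlow] at *
  clear hC hCt
  by_cases q00 : (i, j) ∈ C <;> by_cases q10 : (i + 1, j) ∈ C <;>
    by_cases q01 : (i, j + 1) ∈ C <;> by_cases q11 : (i + 1, j + 1) ∈ C <;>
    simp only [q00, q10, q01, q11, true_and, false_and, if_false, iff_true, iff_false,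
      not_true, imp_false, forall_const] at a1 a2 a3 a4 b1 b2 b3 b4 ⊢ <;>
    rcases x1 with x1 | x1 <;> rcases y1 with y1 | y1 <;> omega

/-- The region of a cell that does not meet the boundary of the grid and has a lower neighbour on
its left is the outermost region inside of a pair of excursions of equal heights. -/
theorem exists_isExc_of_interior {m n : ℕ} {X Y : ℤ → ℤ} (hX : IsWalk X) (hY : IsWalk Y)
    {a j : ℤ} {C : Set (ℤ × ℤ)} (haB : (a, j) ∈ gridBox m n)
    (hC : C = {q | Relation.EqvGen (LevelLink m n X Y) (a, j) q})
    (hbd : ∀ i j, (i, j) ∈ C → 0 < i ∧ i + 1 < n ∧ 0 < j ∧ j + 1 < m)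
    (hmin : ∀ i j, (i, j) ∈ C → a ≤ i) (heven : (X a + Y j) % 2 = 0)
    (hlow : X (a - 1) = X a - 1) :
    ∃ a' b' c' d' h : ℤ, 0 ≤ a' ∧ b' < n ∧ 0 ≤ c' ∧ d' < m ∧ IsExc X a' b' h ∧ IsExc Y c' d' h ∧
      (X a' + Y c' + h) % 2 = 1 ∧
      ∀ k, c' < k → k < d' → Y k = Y c' + h → (a' + 1, k) ∈ C := by
  set t := X a + Y j with ht
  set F : ℤ × ℤ → ℤ := fun p => X p.1 + Y p.2 with hF
  have haC : (a, j) ∈ C := by rw [hC]; exact .refl _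
  have hCB : ∀ p ∈ C, p ∈ gridBox m n := fun p hp => by
    have := hbd p.1 p.2 hp
    exact ⟨by omega, by omega, by omega, by omega⟩
  have hlink : ∀ p q, LevelLink m n X Y p q → (p ∈ C ↔ q ∈ C) := by
    intro x y hxy
    rw [hC]
    exact ⟨fun h => .trans _ _ _ h (.rel _ _ hxy), fun h => .trans _ _ _ h (.symm _ _ (.rel _ _ hxy))⟩
  have hCt : ∀ p ∈ C, t ≤ X p.1 + Y p.2 ∧ X p.1 + Y p.2 ≤ t + 1 := by
    intro p hp
    rw [hC] at hp
    have := (eqvGen_iff_of_forall (P := fun p => (X p.1 + Y p.2) / 2 = t / 2)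
      (fun x y h => by have := h.2.2.1; omega) hp).1 rfl
    omega
  let g : ℕ → ℤ → ℤ := fun i k =>
    ∑ l ∈ Finset.range i, cutFlow C F t ((l : ℤ), k) ((l : ℤ) + 1, k)
  have gsucc : ∀ i k, g (i + 1) k = g i k + cutFlow C F t ((i : ℤ), k) ((i : ℤ) + 1, k) :=
    fun i k => Finset.sum_range_succ _ _
  have flow0 : ∀ p q, p ∉ C → q ∉ C → cutFlow C F t p q = 0 := by
    intro p q h1 h2
    simp [cutFlow, h1, h2]
  have gvert : ∀ (i : ℕ) (k : ℤ), (i : ℤ) < n → 0 ≤ k → k + 1 < m →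
      g i (k + 1) = g i k + cutFlow C F t ((i : ℤ), k) ((i : ℤ), k + 1) := by
    intro i k hi hk hk1
    induction i with
    | zero =>
      rw [flow0]
      · simp [g]
      · intro h; have := hbd _ _ h; simp at this
      · intro h; have := hbd _ _ h; simp at this
    | succ i ih =>
      push_cast at hi
      rw [gsucc, gsucc, ih (by omega)]
      push_cast
      have := cutFlow_closed (i := i) (j := k) hX hY heven hCt hlink
        ⟨by simp, by simp only; omega, hk, by simp only; omega⟩
        ⟨by simp only; omega, by simp only; omega, by simp only; omega, hk1⟩
      linarith
  have grow : ∀ (i : ℕ) (k : ℤ), (∀ i' : ℤ, i' ≤ i → (i', k) ∉ C) → g i k = 0 := by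
    intro i k h
    refine Finset.sum_eq_zero fun l hl => flow0 _ _ (h _ ?_) (h _ ?_)
    · have := Finset.mem_range.1 hl; omega
    · have := Finset.mem_range.1 hl; omega
  have ha0 := hbd _ _ haC
  have gleft : ∀ (i : ℕ) (k : ℤ), (i : ℤ) < a → g i k = 0 := by
    intro i k hi
    refine grow i k fun i' hi' h => ?_
    have := hmin _ _ h
    omega
  have gbdry : ∀ (i : ℕ) (k : ℤ), (i : ℤ) < n → 0 ≤ k → k < m →
      ((i : ℤ) = 0 ∨ (i : ℤ) + 1 = n ∨ k = 0 ∨ k + 1 = m) → g i k = 0 := by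
    intro i k hi hk0 hkm hb
    rcases hb with h | h | rfl | h
    · exact gleft i k (by omega)
    · obtain ⟨k, rfl⟩ := Int.eq_ofNat_of_zero_le hk0
      clear hk0
      induction k with
      | zero =>
        refine grow i _ fun i' _ hh => ?_
        have := hbd _ _ hh
        simp at this
      | succ k ih =>
        push_cast at hkm ⊢
        rw [gvert i k hi (by omega) hkm, ih (by omega), flow0]
        · simp
        · intro hh; have := hbd _ _ hh; omega
        · intro hh; have := hbd _ _ hh; omega
    · refine grow i _ fun i' _ hh => ?_
      have := hbd _ _ hh
      omega
    · refine grow i _ fun i' _ hh => ?_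
      have := hbd _ _ hh
      omega
  have hat : (a, j) ∈ upperSet m n X Y t := ⟨haB, le_rfl⟩
  set U : Set (ℤ × ℤ) := {q | Relation.EqvGen (LinkIn (upperSet m n X Y t)) (a, j) q} with hU
  have hUS : ∀ q, q ∈ U → q ∈ upperSet m n X Y t := by
    intro q hq
    exact (eqvGen_iff_of_forall (P := fun q => q ∈ upperSet m n X Y t)
      (fun x y h => iff_of_true h.1 h.2.1) hq).1 hat
  have ga : g a.toNat j = 1 := by
    have := gsucc (a - 1).toNat j
    rw [gleft (a - 1).toNat j (by omega), show (a - 1).toNat + 1 = a.toNat by omega,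
      show ((a - 1).toNat : ℤ) = a - 1 by omega] at this
    rw [this]
    have h1 : (a - 1, j) ∉ C := fun h => by have := hmin _ _ h; omega
    have h2 : X (a - 1) + Y j < t := by omega
    simp [cutFlow, haC, h1, hF, h2]
  have gU : ∀ q ∈ U, g q.1.toNat q.2 = 1 := by
    intro q hq
    refine (eqvGen_iff_of_forall (P := fun q => g q.1.toNat q.2 = 1) ?_ hq).1 ga
    rintro ⟨x1, x2⟩ y ⟨⟨⟨hx1, hx2, hx3, hx4⟩, hxt⟩, ⟨⟨hy1, hy2, hy3, hy4⟩, hyt⟩, hs⟩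
    simp only at *
    have hc : cutFlow C F t (x1, x2) y = 0 := by
      simp only [cutFlow, hF]
      rw [if_neg (by omega), if_neg (by omega), sub_zero]
    rcases hs with rfl | rfl
    · have := gsucc x1.toNat x2
      rw [Int.toNat_of_nonneg hx1, hc] at this
      simp only at *
      rw [show (x1 + 1).toNat = x1.toNat + 1 by omega, this, add_zero]
    · have := gvert x1.toNat x2 (by omega) hx3 hy4
      rw [Int.toNat_of_nonneg hx1, hc] at this
      simp only at *
      rw [this, add_zero]
  have hUint : ∀ i k, (i, k) ∈ U → 0 < i ∧ i + 1 < n ∧ 0 < k ∧ k + 1 < m := by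
    intro i k hik
    have h1 := gU _ hik
    obtain ⟨⟨h2, h3, h4, h5⟩, -⟩ := hUS _ hik
    simp only at *
    by_contra hcon
    rw [gbdry i.toNat k (by omega) h4 h5 (by omega)] at h1
    omega
  have hcomp := isComp_upper hat hU hUint
  have hfin : U.Finite := by
    refine ((Set.finite_Icc (0 : ℤ) n).prod (Set.finite_Icc (0 : ℤ) m)).subset ?_
    rintro ⟨i, k⟩ hik
    have := hUint _ _ hik
    exact ⟨⟨by simp only; omega, by simp only; omega⟩, ⟨by simp only; omega, by simp only; omega⟩⟩
  obtain ⟨a', b', c', d', h, hE1, hE2, htt, ⟨k1, hk1⟩, ⟨k2, hk2⟩, ⟨k3, hk3⟩, ⟨k4, hk4⟩, hmin', htop⟩ :=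
    hcomp.exists_isExc hX hY hfin ⟨_, Relation.EqvGen.refl (a, j)⟩
  have l1 := hUint _ _ hk1
  have l2 := hUint _ _ hk2
  have l3 := hUint _ _ hk3
  have l4 := hUint _ _ hk4
  refine ⟨a', b', c', d', h, by omega, by omega, by omega, by omega, hE1, hE2, by omega, ?_⟩
  intro k hk hk' hYk
  have hkU := htop k hk hk' hYk
  have g1 := gU _ hkU
  have ha'a : a' < a := hmin' a j (Relation.EqvGen.refl _)
  have := gsucc a'.toNat k
  rw [gleft a'.toNat k (by omega), show a'.toNat + 1 = (a' + 1).toNat by omega, g1,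
      show (a'.toNat : ℤ) = a' by omega] at this
  by_contra hcon
  rw [flow0] at this
  · omega
  · intro hh
    have := hmin _ _ hh
    omega
  · exact hcon

/-- `X` makes an excursion of height exactly `h` that starts at time `a` and ends before `N`. -/
def Exc (X : ℤ → ℤ) (N h a : ℤ) : Prop := ∃ b, b < N ∧ IsExc X a b h

open Classical in
/-- The pairs of starting times of excursions of equal heights at which the parity of the level
is even. -/
noncomputable def excPairs (m n : ℕ) (X Y : ℤ → ℤ) : Finset (ℕ × ℕ) :=
  {q ∈ Finset.range n ×ˢ Finset.range m |
    ∃ h, Exc X n h q.1 ∧ Exc Y m h q.2 ∧ (X q.1 + Y q.2 + h) % 2 = 1}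

theorem mem_excPairs {m n : ℕ} {X Y : ℤ → ℤ} {q : ℕ × ℕ} : q ∈ excPairs m n X Y ↔
    (q.1 < n ∧ q.2 < m) ∧ ∃ h, Exc X n h q.1 ∧ Exc Y m h q.2 ∧ (X q.1 + Y q.2 + h) % 2 = 1 := by
  classical
  simp [excPairs]

/-- The cell `p` is in the first column spanned by the pair of excursions that start at `a` and `c`,
and in a highest row of the second one. -/
def IsPeakCell (m n : ℕ) (X Y : ℤ → ℤ) (a c : ℕ) (p : ℤ × ℤ) : Prop :=
  ∃ b d h k : ℤ, b < n ∧ d < m ∧ IsExc X a b h ∧ IsExc Y c d h ∧ (X a + Y c + h) % 2 = 1 ∧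
    c < k ∧ k < d ∧ Y k = Y c + h ∧ p = ((a : ℤ) + 1, k)

theorem exists_isPeakCell {m n : ℕ} {X Y : ℤ → ℤ} {q : ℕ × ℕ} (hq : q ∈ excPairs m n X Y) :
    ∃ p, IsPeakCell m n X Y q.1 q.2 p := by
  obtain ⟨-, h, ⟨b, hb, hE⟩, ⟨d, hd, hE'⟩, hpar⟩ := mem_excPairs.1 hq
  obtain ⟨k, hk1, hk2, hk3⟩ := hE'.2.2.2
  exact ⟨_, b, d, h, k, hb, hd, hE, hE', hpar, hk1, hk2, hk3, rfl⟩

theorem IsExc.succ {X : ℤ → ℤ} (hX : IsWalk X) {a b h : ℤ} (hE : IsExc X a b h) :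
    a + 1 < b ∧ X (a + 1) = X a + 1 := by
  obtain ⟨i, h1, h2, h3⟩ := hE.2.2.2
  have h4 := hE.2.2.1 (a + 1) (by omega) (by omega)
  have := hX a
  omega

theorem IsExc.pred {X : ℤ → ℤ} (hX : IsWalk X) {a b h : ℤ} (hE : IsExc X a b h) :
    X (b - 1) = X a + 1 := by
  obtain ⟨i, h1, h2, h3⟩ := hE.2.2.2
  have h4 := hE.2.2.1 (b - 1) (by omega) (by omega)
  have := hX.pred b
  have := hE.2.1
  omega

theorem eqvGen_row {m n : ℕ} {X Y : ℤ → ℤ} {t : ℤ} {i i' j : ℤ} (hii : i ≤ i')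
    (h : ∀ l, i ≤ l → l ≤ i' → (l, j) ∈ upperSet m n X Y t) :
    Relation.EqvGen (LinkIn (upperSet m n X Y t)) (i, j) (i', j) := by
  induction i', hii using Int.leInduction with
  | base => exact .refl _
  | succ l hl ih =>
    refine .trans _ _ _ (ih fun l' h1 h2 => h l' h1 (by omega)) (.rel _ _ ⟨?_, ?_, Or.inl rfl⟩)
    · exact h l hl (by omega)
    · exact h (l + 1) (by omega) le_rfl

theorem eqvGen_column {m n : ℕ} {X Y : ℤ → ℤ} {t : ℤ} {i j j' : ℤ} (hjj : j ≤ j')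
    (h : ∀ l, j ≤ l → l ≤ j' → (i, l) ∈ upperSet m n X Y t) :
    Relation.EqvGen (LinkIn (upperSet m n X Y t)) (i, j) (i, j') := by
  induction j', hjj using Int.leInduction with
  | base => exact .refl _
  | succ l hl ih =>
    refine .trans _ _ _ (ih fun l' h1 h2 => h l' h1 (by omega)) (.rel _ _ ⟨?_, ?_, Or.inr rfl⟩)
    · exact h l hl (by omega)
    · exact h (l + 1) (by omega) le_rfl

theorem eqvGen_upper_of_level {m n : ℕ} {X Y : ℤ → ℤ} {p q : ℤ × ℤ}
    (hp : (X p.1 + Y p.2) % 2 = 0) (h : Relation.EqvGen (LevelLink m n X Y) p q) :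
    (X q.1 + Y q.2) / 2 = (X p.1 + Y p.2) / 2 ∧
      Relation.EqvGen (LinkIn (upperSet m n X Y (X p.1 + Y p.2))) p q := by
  set t := X p.1 + Y p.2 with ht
  have key := eqvGen_iff_of_forall (P := fun q => (X q.1 + Y q.2) / 2 = t / 2 ∧
    Relation.EqvGen (LinkIn (upperSet m n X Y t)) p q) ?_ h
  · exact key.1 ⟨rfl, .refl _⟩
  · rintro x y ⟨hx, hy, hxy, hs⟩
    have hl : (X x.1 + Y x.2) / 2 = t / 2 → LinkIn (upperSet m n X Y t) x y :=
      fun hxt => ⟨⟨hx, by omega⟩, ⟨hy, by omega⟩, hs⟩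
    constructor
    · exact fun ⟨h1, h2⟩ => ⟨by omega, .trans _ _ _ h2 (.rel _ _ (hl h1))⟩
    · exact fun ⟨h1, h2⟩ => ⟨by omega, .trans _ _ _ h2 (.symm _ _ (.rel _ _ (hl (by omega))))⟩

theorem IsPeakCell.spec {m n : ℕ} {X Y : ℤ → ℤ} (hX : IsWalk X) (hY : IsWalk Y) {a c : ℕ}
    {p : ℤ × ℤ} (h : IsPeakCell m n X Y a c p) :
    p ∈ gridBox m n ∧ p.1 = a + 1 ∧ X (a + 1) = X a + 1 ∧ (X p.1 + Y p.2) % 2 = 0 ∧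
      (∀ q, Relation.EqvGen (LinkIn (upperSet m n X Y (X p.1 + Y p.2))) p q →
        a < q.1 ∧ c < q.2) ∧
      ∃ i, Relation.EqvGen (LinkIn (upperSet m n X Y (X p.1 + Y p.2))) p (i, c + 1) := by
  obtain ⟨b, d, h, k, hb, hd, hE, hE', hpar, hk1, hk2, hk3, rfl⟩ := h
  obtain ⟨ha1, ha2⟩ := hE.succ hX
  obtain ⟨hc1, hc2⟩ := hE'.succ hY
  have ht : X (a + 1) + Y k = X a + Y c + h + 1 := by omega
  have hmem : ∀ i j : ℤ, a < i → i < b → c < j → j < d → X a + Y c + h + 1 ≤ X i + Y j →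
      (i, j) ∈ upperSet m n X Y (X a + Y c + h + 1) := fun i j h1 h2 h3 h4 h5 =>
    ⟨⟨by simp only; omega, by simp only; omega, by simp only; omega, by simp only; omega⟩, h5⟩
  have hbox := hmem (a + 1) k (by omega) (by omega) (by omega) (by omega) (by omega)
  simp only [ht]
  refine ⟨hbox.1, trivial, ha2, by omega, fun q hq => ?_, ?_⟩
  · have := (eqvGen_iff_of_forall (P := fun q : ℤ × ℤ =>
        a < q.1 ∧ q.1 < b ∧ c < q.2 ∧ q.2 < d) ?_ hq).1
      ⟨by simp only; omega, by simp only; omega, by simp only; omega, by simp only; omega⟩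
    · exact ⟨this.1, this.2.2.1⟩
    · have hXb := hE.2.1
      have hYd := hE'.2.1
      rintro ⟨x1, x2⟩ y ⟨⟨-, hx⟩, ⟨-, hy⟩, hs⟩
      rcases hs with rfl | rfl
      · simp only at *
        constructor
        · rintro ⟨h1, h2, h3, h4⟩
          refine ⟨by omega, ?_, h3, h4⟩
          by_contra hcon
          have := hE'.2.2.1 _ h3 h4
          rw [show x1 + 1 = b by omega] at hy
          omega
        · rintro ⟨h1, h2, h3, h4⟩
          refine ⟨?_, by omega, h3, h4⟩
          by_contra hcon
          have := hE'.2.2.1 _ h3 h4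
          rw [show x1 = a by omega] at hx
          omega
      · simp only at *
        constructor
        · rintro ⟨h1, h2, h3, h4⟩
          refine ⟨h1, h2, by omega, ?_⟩
          by_contra hcon
          have := hE.2.2.1 _ h1 h2
          rw [show x2 + 1 = d by omega] at hy
          omega
        · rintro ⟨h1, h2, h3, h4⟩
          refine ⟨h1, h2, ?_, by omega⟩
          by_contra hcon
          have := hE.2.2.1 _ h1 h2
          rw [show x2 = c by omega] at hx
          omega
  · obtain ⟨i, hi1, hi2, hi3⟩ := hE.2.2.2
    refine ⟨i, .trans _ (i, k) _ (eqvGen_row (by omega) fun l h1 h2 => ?_)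
      (.symm _ _ (eqvGen_column (by omega) fun l h1 h2 => ?_))⟩
    · have := hE.2.2.1 l (by omega) (by omega)
      exact hmem _ _ (by omega) (by omega) (by omega) (by omega) (by omega)
    · have := hE'.2.2.1 l (by omega) (by omega)
      exact hmem _ _ (by omega) (by omega) (by omega) (by omega) (by omega)

theorem IsPeakCell.unique {m n : ℕ} {X Y : ℤ → ℤ} (hX : IsWalk X) (hY : IsWalk Y) {a c a' c' : ℕ}
    {p p' : ℤ × ℤ} (h : IsPeakCell m n X Y a c p) (h' : IsPeakCell m n X Y a' c' p')
    (hpp : Relation.EqvGen (LevelLink m n X Y) p p') : a = a' ∧ c = c' := by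
  obtain ⟨-, h1, -, h2, h3, i, h4⟩ := h.spec hX hY
  obtain ⟨-, h1', -, h2', h3', i', h4'⟩ := h'.spec hX hY
  obtain ⟨e1, e2⟩ := eqvGen_upper_of_level h2 hpp
  have ht : X p'.1 + Y p'.2 = X p.1 + Y p.2 := by omega
  rw [ht] at h3' h4'
  have f1 := (h3 _ e2).1
  have f2 := (h3' _ (.symm _ _ e2)).1
  have f3 := (h3 _ (.trans _ _ _ e2 h4')).2
  have f4 := (h3' _ (.trans _ _ _ (.symm _ _ e2) h4)).2
  simp only at f3 f4
  omega

theorem levelLink_neg {m n : ℕ} {X Y : ℤ → ℤ} :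
    LevelLink m n (fun i => -X i) (fun j => -Y j - 1) = LevelLink m n X Y := by
  funext p q
  simp only [LevelLink, eq_iff_iff]
  have : (-X p.1 + (-Y p.2 - 1)) / 2 = (-X q.1 + (-Y q.2 - 1)) / 2 ↔
      (X p.1 + Y p.2) / 2 = (X q.1 + Y q.2) / 2 := by omega
  rw [this]

theorem IsPeakCell.not_eqvGen_neg {m n : ℕ} {X Y : ℤ → ℤ} (hX : IsWalk X) (hY : IsWalk Y)
    (hX' : IsWalk fun i => -X i) (hY' : IsWalk fun j => -Y j - 1) {a c a' c' : ℕ}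
    {p p' : ℤ × ℤ} (h : IsPeakCell m n X Y a c p)
    (h' : IsPeakCell m n (fun i => -X i) (fun j => -Y j - 1) a' c' p') :
    ¬ Relation.EqvGen (LevelLink m n X Y) p p' := by
  intro hpp
  obtain ⟨-, h1, hs, h2, h3, -⟩ := h.spec hX hY
  obtain ⟨-, h1', hs', h2', h3', -⟩ := h'.spec hX' hY'
  have f1 := (h3 _ (eqvGen_upper_of_level h2 hpp).2).1
  have f2 := (h3' _ (eqvGen_upper_of_level h2' (by
    rw [levelLink_neg]; exact .symm _ _ hpp)).2).1
  obtain rfl : a = a' := by omega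
  omega

theorem IsWalk.neg_sub {X : ℤ → ℤ} (hX : IsWalk X) (c : ℤ) : IsWalk fun i => -X i - c := by
  intro i
  have := hX i
  simp only
  omega

theorem mem_excPairs_of_isExc {m n : ℕ} {X Y : ℤ → ℤ} {a b c d h : ℤ} (ha : 0 ≤ a) (hb : b < n)
    (hc : 0 ≤ c) (hd : d < m) (hE : IsExc X a b h) (hE' : IsExc Y c d h)
    (hpar : (X a + Y c + h) % 2 = 1) : (a.toNat, c.toNat) ∈ excPairs m n X Y := by
  have h1 := hE.1
  have h2 := hE'.1
  have e1 : (a.toNat : ℤ) = a := by omega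
  have e2 : (c.toNat : ℤ) = c := by omega
  rw [mem_excPairs]
  refine ⟨⟨?_, ?_⟩, h, ?_⟩
  · simp only; omega
  · simp only; omega
  · simp only [e1, e2]
    exact ⟨⟨b, hb, hE⟩, ⟨d, hd, hE'⟩, hpar⟩

theorem exists_mem_excPairs_of_interior {m n : ℕ} {X Y : ℤ → ℤ} (hX : IsWalk X) (hY : IsWalk Y)
    {a j : ℤ} (haB : (a, j) ∈ gridBox m n)
    (hbd : ∀ i k, Relation.EqvGen (LevelLink m n X Y) (a, j) (i, k) →
      0 < i ∧ i + 1 < n ∧ 0 < k ∧ k + 1 < m)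
    (hmin : ∀ i k, Relation.EqvGen (LevelLink m n X Y) (a, j) (i, k) → a ≤ i)
    (heven : (X a + Y j) % 2 = 0) (hlow : X (a - 1) = X a - 1) :
    ∃ q ∈ excPairs m n X Y, ∀ p, IsPeakCell m n X Y q.1 q.2 p →
      Relation.EqvGen (LevelLink m n X Y) (a, j) p := by
  obtain ⟨a', b', c', d', h, ha, hb, hc, hd, hE, hE', hpar, hcor⟩ :=
    exists_isExc_of_interior hX hY haB rfl hbd hmin heven hlow
  have e1 : (a'.toNat : ℤ) = a' := by omega
  have e2 : (c'.toNat : ℤ) = c' := by omega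
  obtain ⟨k, hk1, hk2, hk3⟩ := hE'.2.2.2
  refine ⟨_, mem_excPairs_of_isExc ha hb hc hd hE hE' hpar, fun p hp => ?_⟩
  simp only at hp
  have hcor' : IsPeakCell m n X Y a'.toNat c'.toNat (a' + 1, k) :=
    ⟨b', d', h, k, hb, hd, by rwa [e1], by rwa [e2], by rwa [e1, e2], by omega, hk2, by rwa [e2],
      by rw [e1]⟩
  refine .trans _ _ _ (hcor k hk1 hk2 hk3) ?_
  obtain ⟨b2, d2, h2, k2, hb2, hd2, hE2, hE2', hpar2, hk21, hk22, hk23, rfl⟩ := hp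
  rw [e1] at *
  rw [e2] at *
  obtain rfl : d2 = d' := by
    rcases lt_trichotomy d2 d' with hlt | heq | hgt
    · have := hE'.2.2.1 d2 hE2'.1 hlt; have := hE2'.2.1; omega
    · exact heq
    · have := hE2'.2.2.1 d' hE'.1 hgt; have := hE'.2.1; omega
  have hh : h2 = h := by
    have := hE'.2.2.1 k2 hk21 hk22
    have := hE2'.2.2.1 k hk1 hk2
    omega
  exact .trans _ _ _ (.symm _ _ (hcor k hk1 hk2 hk3)) (hcor k2 hk21 hk22 (by omega))

/-- The number of regions of the grid agrees up to a boundary term with the number of pairs of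
excursions of equal heights. -/
theorem card_regions {m n : ℕ} {X Y : ℤ → ℤ} (hX : IsWalk X) (hY : IsWalk Y)
    {K : Type*} (φ : ℤ × ℤ → K) (hsurj : ∀ k, ∃ p ∈ gridBox m n, φ p = k)
    (hφ : ∀ p ∈ gridBox m n, ∀ q ∈ gridBox m n,
      φ p = φ q ↔ Relation.EqvGen (LevelLink m n X Y) p q) :
    (excPairs m n X Y).card + (excPairs m n (fun i => -X i) (fun j => -Y j - 1)).card ≤
        Nat.card K ∧
      Nat.card K ≤ (excPairs m n X Y).card +
        (excPairs m n (fun i => -X i) (fun j => -Y j - 1)).card + 2 * (m + n) := by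
  classical
  have hX' : IsWalk fun i => -X i := by simpa using hX.neg_sub 0
  have hY' := hY.neg_sub 1
  have hfinB : (gridBox m n).Finite := by
    refine ((Set.finite_Icc (0 : ℤ) n).prod (Set.finite_Icc (0 : ℤ) m)).subset ?_
    rintro ⟨i, k⟩ ⟨h1, h2, h3, h4⟩
    exact ⟨⟨h1, h2.le⟩, ⟨h3, h4.le⟩⟩
  have hfinK : Finite K := by
    have : Finite (gridBox m n) := hfinB
    refine Finite.of_surjective (fun p : gridBox m n => φ p) fun k => ?_
    obtain ⟨p, hp, rfl⟩ := hsurj k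
    exact ⟨⟨p, hp⟩, rfl⟩
  have := Fintype.ofFinite K
  set P := excPairs m n X Y with hP
  set Q := excPairs m n (fun i => -X i) (fun j => -Y j - 1) with hQ
  choose! f hf using fun q => exists_isPeakCell (m := m) (n := n) (X := X) (Y := Y) (q := q)
  choose! f' hf' using fun q => exists_isPeakCell (m := m) (n := n)
    (X := fun i => -X i) (Y := fun j => -Y j - 1) (q := q)
  rw [Nat.card_eq_fintype_card]
  constructor
  · have i1 : Set.InjOn (fun q => φ (f q)) P := by
      intro q hq q' hq' h
      have c := hf q hq
      have c' := hf q' hq'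
      have := c.unique hX hY c' ((hφ _ (c.spec hX hY).1 _ (c'.spec hX hY).1).1 h)
      exact Prod.ext this.1 this.2
    have i2 : Set.InjOn (fun q => φ (f' q)) Q := by
      intro q hq q' hq' h
      have c := hf' q hq
      have c' := hf' q' hq'
      have := c.unique hX' hY' c' (by
        rw [levelLink_neg]
        exact (hφ _ (c.spec hX' hY').1 _ (c'.spec hX' hY').1).1 h)
      exact Prod.ext this.1 this.2
    rw [← Finset.card_image_of_injOn i1, ← Finset.card_image_of_injOn i2,
      ← Finset.card_union_of_disjoint]
    · exact Finset.card_le_univ _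
    · rw [Finset.disjoint_left]
      rintro k hk hk'
      obtain ⟨q, hq, rfl⟩ := Finset.mem_image.1 hk
      obtain ⟨q', hq', h⟩ := Finset.mem_image.1 hk'
      have c := hf q hq
      have c' := hf' q' hq'
      exact c.not_eqvGen_neg hX hY hX' hY' c'
        ((hφ _ (c.spec hX hY).1 _ (c'.spec hX' hY').1).1 h.symm)
  · set bd : Finset (ℤ × ℤ) := ({0, (n : ℤ) - 1} : Finset ℤ) ×ˢ Finset.Ico (0 : ℤ) m ∪
      Finset.Ico (0 : ℤ) n ×ˢ ({0, (m : ℤ) - 1} : Finset ℤ) with hbd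
    have hbdcard : bd.card ≤ 2 * (m + n) := by
      refine (Finset.card_union_le _ _).trans ?_
      rw [Finset.card_product, Finset.card_product]
      have h1 : ({0, (n : ℤ) - 1} : Finset ℤ).card ≤ 2 := Finset.card_le_two
      have h2 : ({0, (m : ℤ) - 1} : Finset ℤ).card ≤ 2 := Finset.card_le_two
      simp only [Int.card_Ico, sub_zero, Int.toNat_natCast]
      nlinarith
    have hcover : (Finset.univ : Finset K) ⊆
        P.image (fun q => φ (f q)) ∪ Q.image (fun q => φ (f' q)) ∪ bd.image φ := by
      intro k _
      obtain ⟨p, hpB, rfl⟩ := hsurj k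
      have hpres : ∀ q, Relation.EqvGen (LevelLink m n X Y) p q → q ∈ gridBox m n := fun q hq =>
        (eqvGen_iff_of_forall (P := fun q => q ∈ gridBox m n)
          (fun x y h => iff_of_true h.1 h.2.1) hq).1 hpB
      by_cases hb : ∃ i j, Relation.EqvGen (LevelLink m n X Y) p (i, j) ∧
          ¬ (0 < i ∧ i + 1 < n ∧ 0 < j ∧ j + 1 < m)
      · obtain ⟨i, j, hpij, hij⟩ := hb
        have hB := hpres _ hpij
        refine Finset.mem_union_right _ (Finset.mem_image.2 ⟨(i, j), ?_,
          ((hφ _ hpB _ hB).2 hpij).symm⟩)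
        obtain ⟨h1, h2, h3, h4⟩ := hB
        simp only [hbd, Finset.mem_union, Finset.mem_product, Finset.mem_insert,
          Finset.mem_singleton, Finset.mem_Ico] at *
        omega
      · push Not at hb
        obtain ⟨⟨a, j⟩, haj, hmin⟩ := Set.exists_min_image
          {q | Relation.EqvGen (LevelLink m n X Y) p q} Prod.fst
          (hfinB.subset hpres) ⟨p, .refl _⟩
        have haj : Relation.EqvGen (LevelLink m n X Y) p (a, j) := haj
        have hajB := hpres _ haj
        rw [(hφ _ hpB _ hajB).2 haj]
        have hbd : ∀ i k, Relation.EqvGen (LevelLink m n X Y) (a, j) (i, k) →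
            0 < i ∧ i + 1 < n ∧ 0 < k ∧ k + 1 < m := fun i k h => hb i k (.trans _ _ _ haj h)
        have hmin' : ∀ i k, Relation.EqvGen (LevelLink m n X Y) (a, j) (i, k) → a ≤ i :=
          fun i k h => hmin (i, k) (.trans _ _ _ haj h)
        have h0 := hbd _ _ (.refl _)
        have hne : (X (a - 1) + Y j) / 2 ≠ (X a + Y j) / 2 := by
          intro h
          have := hmin' (a - 1) j (.symm _ _ (.rel _ _ ⟨?_, hajB, h, Or.inl (by simp)⟩))
          · omega
          · exact ⟨by simp only; omega, by simp only; omega, by simp only; omega,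
              by simp only; omega⟩
        refine Finset.mem_union_left _ (Finset.mem_union.2 ?_)
        rcases hX.pred a with hpr | hpr
        · right
          obtain ⟨q, hq, hqc⟩ := exists_mem_excPairs_of_interior (m := m) (n := n) hX' hY' hajB
            (by rwa [levelLink_neg]) (by rwa [levelLink_neg]) (by omega) (by omega)
          have c := hf' q hq
          have := hqc _ c
          rw [levelLink_neg] at this
          exact Finset.mem_image.2 ⟨q, hq, ((hφ _ hajB _ (c.spec hX' hY').1).2 this).symm⟩
        · left
          obtain ⟨q, hq, hqc⟩ := exists_mem_excPairs_of_interior (m := m) (n := n) hX hY hajB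
            hbd hmin' (by omega) (by omega)
          have c := hf q hq
          exact Finset.mem_image.2 ⟨q, hq, ((hφ _ hajB _ (c.spec hX hY).1).2 (hqc _ c)).symm⟩
    have := Finset.card_le_card hcover
    rw [Finset.card_univ] at this
    have h1 := Finset.card_union_le (P.image (fun q => φ (f q)) ∪ Q.image (fun q => φ (f' q)))
      (bd.image φ)
    have h2 := Finset.card_union_le (P.image (fun q => φ (f q))) (Q.image (fun q => φ (f' q)))
    have h3 : (P.image (fun q => φ (f q))).card ≤ P.card := Finset.card_image_le
    have h4 : (Q.image (fun q => φ (f' q))).card ≤ Q.card := Finset.card_image_le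
    have h5 : (bd.image φ).card ≤ bd.card := Finset.card_image_le
    omega

/-- The rectangle `[0,n] × [0,m]` without the stitches of the pattern. -/
def complementOf (m n : ℕ) (ε η : ℤ → ZMod 2) : Set (ℝ × ℝ) :=
  (Set.Icc (0:ℝ) (n:ℝ) ×ˢ Set.Icc (0:ℝ) (m:ℝ)) \
    curveOf {s : Stitch | s.InPattern ε η ∧ s.inGrid m n}

/-- The closed unit cell with southwest corner `c`. -/
def closedCell (c : ℤ × ℤ) : Set (ℝ × ℝ) :=
  Set.Icc (c.1 : ℝ) (c.1 + 1) ×ˢ Set.Icc (c.2 : ℝ) (c.2 + 1)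

/-- The centre of the unit cell with southwest corner `c`. -/
noncomputable def cellCenter (c : ℤ × ℤ) : ℝ × ℝ := ((c.1 : ℝ) + 1 / 2, (c.2 : ℝ) + 1 / 2)

/-- Neighbouring cells of the grid that are not separated by a stitch. -/
def CellLink (m n : ℕ) (ε η : ℤ → ZMod 2) (p q : ℤ × ℤ) : Prop :=
  p ∈ gridBox m n ∧ q ∈ gridBox m n ∧
    ((q = (p.1 + 1, p.2) ∧ (p.2 : ZMod 2) ≠ ε (p.1 + 1)) ∨
      (q = (p.1, p.2 + 1) ∧ (p.1 : ZMod 2) ≠ η (p.2 + 1)))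

theorem mem_seg_vert {i j : ℤ} {p : ℝ × ℝ} :
    p ∈ (Stitch.vert i j).seg ↔ p.1 = i ∧ (j : ℝ) ≤ p.2 ∧ p.2 ≤ j + 1 := by
  obtain ⟨x, y⟩ := p
  rw [Stitch.seg, segment_eq_image]
  simp only [Set.mem_image, Set.mem_Icc, Prod.ext_iff, Prod.fst_add, Prod.snd_add, Prod.smul_fst,
    Prod.smul_snd, smul_eq_mul]
  constructor
  · rintro ⟨t, ⟨h0, h1⟩, rfl, rfl⟩
    refine ⟨by ring, ?_, ?_⟩ <;> nlinarith
  · rintro ⟨rfl, h0, h1⟩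
    exact ⟨y - j, ⟨by linarith, by linarith⟩, by ring, by ring⟩

theorem mem_seg_horiz {i j : ℤ} {p : ℝ × ℝ} :
    p ∈ (Stitch.horiz i j).seg ↔ p.2 = j ∧ (i : ℝ) ≤ p.1 ∧ p.1 ≤ i + 1 := by
  obtain ⟨x, y⟩ := p
  rw [Stitch.seg, segment_eq_image]
  simp only [Set.mem_image, Set.mem_Icc, Prod.ext_iff, Prod.fst_add, Prod.snd_add, Prod.smul_fst,
    Prod.smul_snd, smul_eq_mul]
  constructor
  · rintro ⟨t, ⟨h0, h1⟩, rfl, rfl⟩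
    refine ⟨by ring, ?_, ?_⟩ <;> nlinarith
  · rintro ⟨rfl, h0, h1⟩
    exact ⟨x - i, ⟨by linarith, by linarith⟩, by ring, by ring⟩

theorem mem_complementOf {m n : ℕ} {ε η : ℤ → ZMod 2} {p : ℝ × ℝ} :
    p ∈ complementOf m n ε η ↔ ((0 ≤ p.1 ∧ p.1 ≤ n) ∧ 0 ≤ p.2 ∧ p.2 ≤ m) ∧
      (∀ i j : ℤ, 0 ≤ i → i ≤ n → 0 ≤ j → j + 1 ≤ m → p.1 = i → (j : ℝ) ≤ p.2 → p.2 ≤ j + 1 →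
        (j : ZMod 2) ≠ ε i) ∧
      (∀ i j : ℤ, 0 ≤ i → i + 1 ≤ n → 0 ≤ j → j ≤ m → p.2 = j → (i : ℝ) ≤ p.1 → p.1 ≤ i + 1 →
        (i : ZMod 2) ≠ η j) := by
  rw [complementOf, Set.mem_sdiff, Set.mem_prod, Set.mem_Icc, Set.mem_Icc]
  refine and_congr Iff.rfl ?_
  simp only [curveOf, Set.mem_iUnion, not_exists]
  constructor
  · refine fun h => ⟨fun i j h1 h2 h3 h4 h5 h6 h7 h8 => ?_, fun i j h1 h2 h3 h4 h5 h6 h7 h8 => ?_⟩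
    · exact h (.vert i j) ⟨h8, h1, h2, h3, h4⟩ (mem_seg_vert.2 ⟨h5, h6, h7⟩)
    · exact h (.horiz i j) ⟨h8, h1, h2, h3, h4⟩ (mem_seg_horiz.2 ⟨h5, h6, h7⟩)
  · rintro ⟨h1, h2⟩ (⟨i, j⟩ | ⟨i, j⟩) ⟨hP, hG⟩ hs
    · obtain ⟨a, b, c⟩ := mem_seg_vert.1 hs
      exact h1 i j hG.1 hG.2.1 hG.2.2.1 hG.2.2.2 a b c hP
    · obtain ⟨a, b, c⟩ := mem_seg_horiz.1 hs
      exact h2 i j hG.1 hG.2.1 hG.2.2.1 hG.2.2.2 a b c hP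

theorem false_of_lt_of_lt_add_one {a i : ℤ} {x : ℝ} (hi : x = i) (h1 : (a : ℝ) < x)
    (h2 : x < a + 1) : False := by
  subst hi
  have h1 : a < i := by exact_mod_cast h1
  have h2 : i < a + 1 := by exact_mod_cast h2
  omega

theorem gridBox_cast {m n : ℕ} {c : ℤ × ℤ} (hc : c ∈ gridBox m n) :
    (0 : ℝ) ≤ c.1 ∧ (c.1 : ℝ) + 1 ≤ n ∧ (0 : ℝ) ≤ c.2 ∧ (c.2 : ℝ) + 1 ≤ m := by
  obtain ⟨h1, h2, h3, h4⟩ := hc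
  refine ⟨by exact_mod_cast h1, ?_, by exact_mod_cast h3, ?_⟩
  · exact_mod_cast (show c.1 + 1 ≤ n by omega)
  · exact_mod_cast (show c.2 + 1 ≤ m by omega)

theorem mem_complementOf_of_mem_interior {m n : ℕ} {ε η : ℤ → ZMod 2} {c : ℤ × ℤ}
    (hc : c ∈ gridBox m n) {p : ℝ × ℝ} (h1 : (c.1 : ℝ) < p.1) (h2 : p.1 < c.1 + 1)
    (h3 : (c.2 : ℝ) < p.2) (h4 : p.2 < c.2 + 1) : p ∈ complementOf m n ε η := by
  obtain ⟨a1, a2, a3, a4⟩ := gridBox_cast hc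
  refine mem_complementOf.2 ⟨⟨⟨by linarith, by linarith⟩, by linarith, by linarith⟩, ?_, ?_⟩
  · intro i j _ _ _ _ h
    exact (false_of_lt_of_lt_add_one h h1 h2).elim
  · intro i j _ _ _ _ h
    exact (false_of_lt_of_lt_add_one h h3 h4).elim

theorem lt_of_mem_Icc_of_pos {a x t : ℝ} (h0 : a ≤ x) (h1 : x ≤ a + 1) (ht : 0 < t) (ht1 : t ≤ 1) :
    a < (1 - t) * x + t * (a + 1 / 2) ∧ (1 - t) * x + t * (a + 1 / 2) < a + 1 := by
  constructor <;> nlinarith [mul_nonneg (sub_nonneg.2 ht1) (sub_nonneg.2 h0),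
    mul_nonneg (sub_nonneg.2 ht1) (sub_nonneg.2 h1)]

theorem segment_subset_complementOf {m n : ℕ} {ε η : ℤ → ZMod 2} {c : ℤ × ℤ}
    (hc : c ∈ gridBox m n) {p : ℝ × ℝ} (hp : p ∈ complementOf m n ε η) (hpc : p ∈ closedCell c) :
    segment ℝ p (cellCenter c) ⊆ complementOf m n ε η := by
  obtain ⟨⟨h1, h2⟩, h3, h4⟩ := hpc
  rw [segment_eq_image]
  rintro _ ⟨t, ⟨ht0, ht1⟩, rfl⟩
  rcases ht0.eq_or_lt with rfl | ht
  · simpa using hp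
  · have e1 := lt_of_mem_Icc_of_pos h1 h2 ht ht1
    have e2 := lt_of_mem_Icc_of_pos h3 h4 ht ht1
    exact mem_complementOf_of_mem_interior hc e1.1 e1.2 e2.1 e2.2

theorem connectedComponentIn_eq_cellCenter {m n : ℕ} {ε η : ℤ → ZMod 2} {c : ℤ × ℤ}
    (hc : c ∈ gridBox m n) {p : ℝ × ℝ} (hp : p ∈ complementOf m n ε η) (hpc : p ∈ closedCell c) :
    connectedComponentIn (complementOf m n ε η) p =
      connectedComponentIn (complementOf m n ε η) (cellCenter c) :=
  connectedComponentIn_eq ((convex_segment p (cellCenter c)).isPreconnected.subset_connectedComponentIn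
    (left_mem_segment _ _ _) (segment_subset_complementOf hc hp hpc) (right_mem_segment _ _ _))

theorem cellCenter_mem {m n : ℕ} {ε η : ℤ → ZMod 2} {c : ℤ × ℤ} (hc : c ∈ gridBox m n) :
    cellCenter c ∈ complementOf m n ε η := by
  refine mem_complementOf_of_mem_interior hc ?_ ?_ ?_ ?_ <;> simp only [cellCenter] <;> linarith

theorem cellCenter_mem_closedCell (c : ℤ × ℤ) : cellCenter c ∈ closedCell c := by
  refine ⟨⟨?_, ?_⟩, ?_, ?_⟩ <;> simp only [cellCenter] <;> linarith

theorem exists_int_mem_unit {N : ℕ} (hN : 0 < N) {x : ℝ} (h0 : 0 ≤ x) (h1 : x ≤ N) :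
    ∃ i : ℤ, 0 ≤ i ∧ i < N ∧ (i : ℝ) ≤ x ∧ x ≤ i + 1 := by
  rcases h1.lt_or_eq with h | rfl
  · refine ⟨⌊x⌋, Int.floor_nonneg.2 h0, ?_, Int.floor_le x, (Int.lt_floor_add_one x).le⟩
    rw [Int.floor_lt]
    exact_mod_cast h
  · refine ⟨N - 1, by omega, by omega, ?_, ?_⟩ <;> push_cast <;> linarith

theorem exists_closedCell {m n : ℕ} (hm : 0 < m) (hn : 0 < n) {ε η : ℤ → ZMod 2} {p : ℝ × ℝ}
    (hp : p ∈ complementOf m n ε η) : ∃ c ∈ gridBox m n, p ∈ closedCell c := by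
  obtain ⟨⟨⟨h1, h2⟩, h3, h4⟩, -⟩ := mem_complementOf.1 hp
  obtain ⟨i, a1, a2, a3, a4⟩ := exists_int_mem_unit hn h1 h2
  obtain ⟨j, b1, b2, b3, b4⟩ := exists_int_mem_unit hm h3 h4
  exact ⟨(i, j), ⟨a1, a2, b1, b2⟩, ⟨a3, a4⟩, b3, b4⟩

theorem CellLink.connectedComponentIn_eq {m n : ℕ} {ε η : ℤ → ZMod 2} {p q : ℤ × ℤ}
    (h : CellLink m n ε η p q) :
    connectedComponentIn (complementOf m n ε η) (cellCenter p) =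
      connectedComponentIn (complementOf m n ε η) (cellCenter q) := by
  obtain ⟨hp, hq, h⟩ := h
  obtain ⟨a1, a2, a3, a4⟩ := gridBox_cast hp
  obtain ⟨b1, b2, b3, b4⟩ := gridBox_cast hq
  rcases h with ⟨rfl, h⟩ | ⟨rfl, h⟩
  · have hr : ((p.1 : ℝ) + 1, (p.2 : ℝ) + 1 / 2) ∈ complementOf m n ε η := by
      refine mem_complementOf.2 ⟨⟨⟨?_, ?_⟩, ?_, ?_⟩, ?_, ?_⟩
      · simp only; linarith
      · simp only; linarith
      · simp only; linarith
      · simp only; linarith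
      · intro i j _ _ _ _ e e1 e2
        simp only at e e1 e2
        have e : p.1 + 1 = i := by exact_mod_cast e
        have e1 : j < p.2 + 1 := by
          have : (j : ℝ) < ((p.2 + 1 : ℤ) : ℝ) := by push_cast; linarith
          exact_mod_cast this
        have e2 : p.2 < j + 1 := by
          have : (p.2 : ℝ) < ((j + 1 : ℤ) : ℝ) := by push_cast; linarith
          exact_mod_cast this
        obtain rfl : j = p.2 := by omega
        rwa [← e]
      · intro i j _ _ _ _ e
        refine (false_of_lt_of_lt_add_one (a := p.2) e ?_ ?_).elim <;> simp only <;> linarith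
    rw [← connectedComponentIn_eq_cellCenter hp hr, ← connectedComponentIn_eq_cellCenter hq hr]
    · refine ⟨⟨?_, ?_⟩, ?_, ?_⟩ <;> simp only <;> push_cast <;> linarith
    · refine ⟨⟨?_, ?_⟩, ?_, ?_⟩ <;> simp only <;> linarith
  · have hr : ((p.1 : ℝ) + 1 / 2, (p.2 : ℝ) + 1) ∈ complementOf m n ε η := by
      refine mem_complementOf.2 ⟨⟨⟨?_, ?_⟩, ?_, ?_⟩, ?_, ?_⟩
      · simp only; linarith
      · simp only; linarith
      · simp only; linarith
      · simp only; linarith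
      · intro i j _ _ _ _ e
        refine (false_of_lt_of_lt_add_one (a := p.1) e ?_ ?_).elim <;> simp only <;> linarith
      · intro i j _ _ _ _ e e1 e2
        simp only at e e1 e2
        have e : p.2 + 1 = j := by exact_mod_cast e
        have e1 : i < p.1 + 1 := by
          have : (i : ℝ) < ((p.1 + 1 : ℤ) : ℝ) := by push_cast; linarith
          exact_mod_cast this
        have e2 : p.1 < i + 1 := by
          have : (p.1 : ℝ) < ((i + 1 : ℤ) : ℝ) := by push_cast; linarith
          exact_mod_cast this
        obtain rfl : i = p.1 := by omega
        rwa [← e]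
    rw [← connectedComponentIn_eq_cellCenter hp hr, ← connectedComponentIn_eq_cellCenter hq hr]
    · refine ⟨⟨?_, ?_⟩, ?_, ?_⟩ <;> simp only <;> push_cast <;> linarith
    · refine ⟨⟨?_, ?_⟩, ?_, ?_⟩ <;> simp only <;> linarith

theorem int_cases_of_mem_unit {a b : ℤ} {x : ℝ} (h1 : (a : ℝ) ≤ x) (h2 : x ≤ a + 1)
    (h3 : (b : ℝ) ≤ x) (h4 : x ≤ b + 1) :
    a = b ∨ (b = a + 1 ∧ x = b) ∨ (a = b + 1 ∧ x = a) := by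
  have e1 : a ≤ b + 1 := by exact_mod_cast h1.trans h4
  have e2 : b ≤ a + 1 := by exact_mod_cast h3.trans h2
  rcases (show a = b ∨ b = a + 1 ∨ a = b + 1 by omega) with h | rfl | rfl
  · exact Or.inl h
  · refine Or.inr (Or.inl ⟨rfl, le_antisymm ?_ h3⟩)
    push_cast
    exact h2
  · refine Or.inr (Or.inr ⟨rfl, le_antisymm ?_ h1⟩)
    push_cast
    exact h4

theorem vertex_notMem_complementOf {m n : ℕ} {ε η : ℤ → ZMod 2} {i j : ℤ} (hi : 0 ≤ i)
    (hi' : i ≤ n) (hj : 0 < j) (hj' : j < m) : ((i : ℝ), (j : ℝ)) ∉ complementOf m n ε η := by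
  intro h
  obtain ⟨-, h, -⟩ := mem_complementOf.1 h
  have h1 := h i j hi hi' (by omega) (by omega) rfl le_rfl (by simp)
  have h2 := h i (j - 1) hi hi' (by omega) (by omega) rfl (by simp) (by simp)
  push_cast at h2
  generalize (j : ZMod 2) = u at *
  generalize ε i = v at *
  revert u v
  decide

theorem eqvGen_cellLink_of_mem {m n : ℕ} {ε η : ℤ → ZMod 2} {c d : ℤ × ℤ}
    (hc : c ∈ gridBox m n) (hd : d ∈ gridBox m n) {p : ℝ × ℝ} (hp : p ∈ complementOf m n ε η)
    (hpc : p ∈ closedCell c) (hpd : p ∈ closedCell d) :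
    Relation.EqvGen (CellLink m n ε η) c d := by
  obtain ⟨⟨h1, h2⟩, h3, h4⟩ := hpc
  obtain ⟨⟨k1, k2⟩, k3, k4⟩ := hpd
  obtain ⟨a, b⟩ := c
  obtain ⟨a', b'⟩ := d
  obtain ⟨x, y⟩ := p
  have hp' := mem_complementOf.1 hp
  obtain ⟨c1, c2, c3, c4⟩ := hc
  obtain ⟨d1, d2, d3, d4⟩ := hd
  simp only at *
  rcases int_cases_of_mem_unit h1 h2 k1 k2 with rfl | ⟨rfl, rfl⟩ | ⟨rfl, rfl⟩
  · rcases int_cases_of_mem_unit h3 h4 k3 k4 with rfl | ⟨rfl, rfl⟩ | ⟨rfl, rfl⟩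
    · exact .refl _
    · exact .rel _ _ ⟨⟨c1, c2, c3, c4⟩, ⟨d1, d2, d3, d4⟩, Or.inr ⟨rfl, hp'.2.2 a _ (by omega)
        (by omega) (by omega) (by omega) rfl h1 h2⟩⟩
    · exact .symm _ _ (.rel _ _ ⟨⟨d1, d2, d3, d4⟩, ⟨c1, c2, c3, c4⟩, Or.inr ⟨rfl, hp'.2.2 a _
        (by omega) (by omega) (by omega) (by omega) rfl h1 h2⟩⟩)
  · rcases int_cases_of_mem_unit h3 h4 k3 k4 with rfl | ⟨rfl, rfl⟩ | ⟨rfl, rfl⟩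
    · exact .rel _ _ ⟨⟨c1, c2, c3, c4⟩, ⟨d1, d2, d3, d4⟩, Or.inl ⟨rfl, hp'.2.1 _ b (by omega)
        (by omega) (by omega) (by omega) rfl h3 h4⟩⟩
    · exact (vertex_notMem_complementOf (by omega) (by omega) (by omega) (by omega) hp).elim
    · exact (vertex_notMem_complementOf (by omega) (by omega) (by omega) (by omega) hp).elim
  · rcases int_cases_of_mem_unit h3 h4 k3 k4 with rfl | ⟨rfl, rfl⟩ | ⟨rfl, rfl⟩
    · exact .symm _ _ (.rel _ _ ⟨⟨d1, d2, d3, d4⟩, ⟨c1, c2, c3, c4⟩, Or.inl ⟨rfl, hp'.2.1 _ b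
        (by omega) (by omega) (by omega) (by omega) rfl h3 h4⟩⟩)
    · exact (vertex_notMem_complementOf (by omega) (by omega) (by omega) (by omega) hp).elim
    · exact (vertex_notMem_complementOf (by omega) (by omega) (by omega) (by omega) hp).elim

theorem gridBox_finite (m n : ℕ) : (gridBox m n).Finite :=
  (Set.finite_Icc ((0 : ℤ), (0 : ℤ)) ((n : ℤ), (m : ℤ))).subset
    fun _ hp => ⟨⟨hp.1, hp.2.2.1⟩, hp.2.1.le, hp.2.2.2.le⟩

theorem isClosed_closedCell (c : ℤ × ℤ) : IsClosed (closedCell c) := isClosed_Icc.prod isClosed_Icc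

theorem eqvGen_of_mem_connectedComponentIn {m n : ℕ} (hm : 0 < m) (hn : 0 < n) {ε η : ℤ → ZMod 2}
    {c d : ℤ × ℤ} (hc : c ∈ gridBox m n) (hd : d ∈ gridBox m n)
    (h : cellCenter d ∈ connectedComponentIn (complementOf m n ε η) (cellCenter c)) :
    Relation.EqvGen (CellLink m n ε η) c d := by
  by_contra hcd
  have hcl : ∀ P : ℤ × ℤ → Prop, IsClosed (⋃ e ∈ {e | e ∈ gridBox m n ∧ P e}, closedCell e) :=
    fun P => ((gridBox_finite m n).subset fun _ he => he.1).isClosed_biUnion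
      fun e _ => isClosed_closedCell e
  have hsub := connectedComponentIn_subset (complementOf m n ε η) (cellCenter c)
  obtain ⟨p, hp, hp1, hp2⟩ := isPreconnected_closed_iff.1
    (isPreconnected_connectedComponentIn (x := cellCenter c) (F := complementOf m n ε η)) _ _
    (hcl fun e => Relation.EqvGen (CellLink m n ε η) c e)
    (hcl fun e => ¬ Relation.EqvGen (CellLink m n ε η) c e)
    (fun p hp => by
      obtain ⟨e, he, hpe⟩ := exists_closedCell hm hn (hsub hp)
      by_cases hce : Relation.EqvGen (CellLink m n ε η) c e
      · exact Or.inl (Set.mem_biUnion ⟨he, hce⟩ hpe)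
      · exact Or.inr (Set.mem_biUnion ⟨he, hce⟩ hpe))
    ⟨_, mem_connectedComponentIn (cellCenter_mem hc),
      Set.mem_biUnion ⟨hc, .refl _⟩ (cellCenter_mem_closedCell c)⟩
    ⟨_, h, Set.mem_biUnion ⟨hd, hcd⟩ (cellCenter_mem_closedCell d)⟩
  simp only [Set.mem_iUnion] at hp1 hp2
  obtain ⟨e, ⟨he, hce⟩, hpe⟩ := hp1
  obtain ⟨f, ⟨hf, hcf⟩, hpf⟩ := hp2
  exact hcf (.trans _ _ _ hce (eqvGen_cellLink_of_mem he hf (hsub hp) hpe hpf))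

/-- The components of the complement of the pattern are the classes of cells of the grid that can
be linked without crossing a stitch. -/
theorem connectedComponentIn_eq_iff {m n : ℕ} (hm : 0 < m) (hn : 0 < n) {ε η : ℤ → ZMod 2}
    {c d : ℤ × ℤ} (hc : c ∈ gridBox m n) (hd : d ∈ gridBox m n) :
    connectedComponentIn (complementOf m n ε η) (cellCenter c) =
      connectedComponentIn (complementOf m n ε η) (cellCenter d) ↔
      Relation.EqvGen (CellLink m n ε η) c d := by
  constructor
  · intro h
    refine eqvGen_of_mem_connectedComponentIn hm hn hc hd ?_
    rw [h]
    exact mem_connectedComponentIn (cellCenter_mem hd)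
  · intro h
    clear hc hd
    induction h with
    | rel p q h => exact h.connectedComponentIn_eq
    | refl => rfl
    | symm p q _ ih => exact ih.symm
    | trans p q r _ _ ih1 ih2 => exact ih1.trans ih2

/-- The value `1` or `-1` of a step. -/
def stepVal (s : Bool) : ℤ := if s then 1 else -1

/-- The position after `k` steps of the walk with steps `w`. -/
def walkSum (w : List Bool) (k : ℕ) : ℤ := ∑ i ∈ Finset.range k, stepVal (w.getD i true)

/-- The walk with steps `w`, extended to negative times by reflection. -/
def walkOf (w : List Bool) (i : ℤ) : ℤ := walkSum w i.natAbs

/-- The steps that the labels of the lines `1, …, L` determine. -/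
def wordOf (L : ℕ) (ε : ℤ → ZMod 2) : List Bool :=
  List.ofFn fun k : Fin L => decide (ε ((k : ℕ) + 1 : ℤ) = (((k : ℕ) + 1 : ℤ) : ZMod 2))

theorem stepVal_eq (s : Bool) : stepVal s = 1 ∨ stepVal s = -1 := by
  cases s <;> simp [stepVal]

theorem stepVal_not (s : Bool) : stepVal (!s) = -stepVal s := by
  cases s <;> simp [stepVal]

theorem walkSum_zero (w : List Bool) : walkSum w 0 = 0 := rfl

theorem walkSum_succ (w : List Bool) (k : ℕ) :
    walkSum w (k + 1) = walkSum w k + stepVal (w.getD k true) := Finset.sum_range_succ _ _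

theorem walkSum_cons (s : Bool) (w : List Bool) (k : ℕ) :
    walkSum (s :: w) (k + 1) = stepVal s + walkSum w k := by
  rw [walkSum, Finset.sum_range_succ', add_comm]
  simp [walkSum]

theorem walkSum_map_not (w : List Bool) {k : ℕ} (hk : k ≤ w.length) :
    walkSum (w.map (!·)) k = -walkSum w k := by
  induction k with
  | zero => simp [walkSum_zero]
  | succ k ih =>
    rw [walkSum_succ, walkSum_succ, ih (by omega), neg_add, ← stepVal_not]
    congr 2
    rw [List.getD_eq_getElem _ _ (by simpa using hk), List.getD_eq_getElem _ _ (by omega)]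
    simp

theorem walkOf_natCast (w : List Bool) (k : ℕ) : walkOf w k = walkSum w k := rfl

theorem isWalk_walkOf (w : List Bool) : IsWalk (walkOf w) := by
  intro i
  rcases le_or_gt 0 i with h | h
  · have e : (i + 1).natAbs = i.natAbs + 1 := by omega
    rw [walkOf, walkOf, e, walkSum_succ]
    have := stepVal_eq (w.getD i.natAbs true)
    omega
  · have e : i.natAbs = (i + 1).natAbs + 1 := by omega
    rw [walkOf, walkOf, e, walkSum_succ]
    have := stepVal_eq (w.getD (i + 1).natAbs true)
    omega

theorem walkOf_parity (w : List Bool) {i : ℤ} (hi : 0 ≤ i) : (walkOf w i - i) % 2 = 0 := by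
  induction i, hi using Int.leInduction with
  | base => rfl
  | succ l _ ih =>
    have := isWalk_walkOf w l
    omega

theorem walkOf_wordOf_succ {L : ℕ} {ε : ℤ → ZMod 2} {i : ℤ} (hi : 0 ≤ i) (hL : i < L) :
    walkOf (wordOf L ε) (i + 1) =
      walkOf (wordOf L ε) i + if ε (i + 1) = ((i + 1 : ℤ) : ZMod 2) then 1 else -1 := by
  obtain ⟨k, rfl⟩ := Int.eq_ofNat_of_zero_le hi
  have hk : k < L := by omega
  have e : ((k : ℤ) + 1).natAbs = k + 1 := by omega
  rw [walkOf, walkOf, e, walkSum_succ, List.getD_eq_getElem _ _ (by simpa [wordOf] using hk)]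
  simp [wordOf, stepVal]

theorem ne_label_iff {a b i j : ℤ} {u : ZMod 2} (ha : (a - i) % 2 = 0) (hb : (b - j) % 2 = 0) :
    (j : ZMod 2) ≠ u ↔
      (a + b) / 2 = (a + (if u = ((i + 1 : ℤ) : ZMod 2) then 1 else -1) + b) / 2 := by
  obtain ⟨e, rfl⟩ := ZMod.intCast_surjective u
  have h : ∀ x y : ℤ, ((x : ZMod 2) = (y : ZMod 2)) ↔ x % 2 = y % 2 := fun x y =>
    ZMod.intCast_eq_intCast_iff x y 2
  rw [Ne, h]
  simp only [h]
  split_ifs <;> omega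

theorem cellLink_iff_levelLink {m n : ℕ} {ε η : ℤ → ZMod 2} {p q : ℤ × ℤ} :
    CellLink m n ε η p q ↔
      LevelLink m n (walkOf (wordOf (n - 1) ε)) (walkOf (wordOf (m - 1) η)) p q := by
  rw [CellLink, LevelLink]
  refine and_congr_right fun hp => and_congr_right fun hq => ?_
  obtain ⟨i, j⟩ := p
  obtain ⟨h1, h2, h3, h4⟩ := hp
  simp only at h1 h2 h3 h4
  rw [StepTo, and_or_left]
  refine or_congr ?_ ?_
  · rw [and_comm]
    refine and_congr_left ?_
    rintro rfl
    have := hq.2.1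
    simp only at this ⊢
    rw [walkOf_wordOf_succ h1 (by omega)]
    exact ne_label_iff (walkOf_parity _ h1) (walkOf_parity _ h3)
  · rw [and_comm]
    refine and_congr_left ?_
    rintro rfl
    have := hq.2.2.2
    simp only at this ⊢
    rw [walkOf_wordOf_succ h3 (by omega), add_comm (walkOf _ i),
      add_comm (walkOf _ i)]
    exact ne_label_iff (walkOf_parity _ h3) (walkOf_parity _ h1)

/-- The number of pairs of excursions of equal heights, split according to the parity of the level. -/
noncomputable def excPairsCount (m n : ℕ) (X Y : ℤ → ℤ) : ℕ :=
  (excPairs m n X Y).card + (excPairs m n (fun i => -X i) (fun j => -Y j - 1)).card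

theorem regionsCount_bounds {m n : ℕ} (hm : 0 < m) (hn : 0 < n) (ε η : ℤ → ZMod 2) :
    excPairsCount m n (walkOf (wordOf (n - 1) ε)) (walkOf (wordOf (m - 1) η)) ≤
        RegionsCount m n ε η ∧
      RegionsCount m n ε η ≤
        excPairsCount m n (walkOf (wordOf (n - 1) ε)) (walkOf (wordOf (m - 1) η)) +
          2 * (m + n) := by
  classical
  have h0 : ((0 : ℤ), (0 : ℤ)) ∈ gridBox m n := ⟨le_rfl, by simpa, le_rfl, by simpa⟩
  refine card_regions (K := {C : Set (ℝ × ℝ) // ∃ p ∈ complementOf m n ε η,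
    C = connectedComponentIn (complementOf m n ε η) p}) (isWalk_walkOf _) (isWalk_walkOf _)
    (fun c => if h : c ∈ gridBox m n then ⟨_, _, cellCenter_mem h, rfl⟩
      else ⟨_, _, cellCenter_mem h0, rfl⟩) ?_ ?_
  · rintro ⟨_, p, hp, rfl⟩
    obtain ⟨c, hc, hpc⟩ := exists_closedCell hm hn hp
    exact ⟨c, hc, by simp [hc, connectedComponentIn_eq_cellCenter hc hp hpc]⟩
  · intro p hp q hq
    have e : LevelLink m n (walkOf (wordOf (n - 1) ε)) (walkOf (wordOf (m - 1) η)) =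
        CellLink m n ε η := by
      funext a b
      exact propext cellLink_iff_levelLink.symm
    rw [e, ← connectedComponentIn_eq_iff hm hn hp hq]
    simp [hp, hq]

/-- The average of `φ` over all words of length `L`. -/
noncomputable def wordAvg : ℕ → (List Bool → ℝ) → ℝ
  | 0, φ => φ []
  | L + 1, φ => (wordAvg L (fun w => φ (true :: w)) + wordAvg L (fun w => φ (false :: w))) / 2

theorem wordAvg_congr {L : ℕ} {φ ψ : List Bool → ℝ} (h : ∀ w, w.length = L → φ w = ψ w) :
    wordAvg L φ = wordAvg L ψ := by
  induction L generalizing φ ψ with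
  | zero => exact h [] rfl
  | succ L ih =>
    rw [wordAvg, wordAvg, ih fun w hw => h (true :: w) (by simp [hw]),
      ih fun w hw => h (false :: w) (by simp [hw])]

theorem wordAvg_mono {L : ℕ} {φ ψ : List Bool → ℝ} (h : ∀ w, φ w ≤ ψ w) :
    wordAvg L φ ≤ wordAvg L ψ := by
  induction L generalizing φ ψ with
  | zero => exact h []
  | succ L ih =>
    have h1 := ih fun w => h (true :: w)
    have h2 := ih fun w => h (false :: w)
    rw [wordAvg, wordAvg]
    linarith

theorem wordAvg_add (L : ℕ) (φ ψ : List Bool → ℝ) :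
    wordAvg L (fun w => φ w + ψ w) = wordAvg L φ + wordAvg L ψ := by
  induction L generalizing φ ψ with
  | zero => rfl
  | succ L ih => simp only [wordAvg, ih]; ring

theorem wordAvg_mul (L : ℕ) (c : ℝ) (φ : List Bool → ℝ) :
    wordAvg L (fun w => c * φ w) = c * wordAvg L φ := by
  induction L generalizing φ with
  | zero => rfl
  | succ L ih => simp only [wordAvg, ih]; ring

theorem wordAvg_const (L : ℕ) (c : ℝ) : wordAvg L (fun _ => c) = c := by
  induction L with
  | zero => rfl
  | succ L ih => simp only [wordAvg, ih]; ring

theorem wordAvg_sum {ι : Type*} (s : Finset ι) (L : ℕ) (φ : ι → List Bool → ℝ) :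
    wordAvg L (fun w => ∑ k ∈ s, φ k w) = ∑ k ∈ s, wordAvg L (φ k) := by
  classical
  induction s using Finset.induction_on with
  | empty => simp [wordAvg_const]
  | insert a s ha ih => simp only [Finset.sum_insert ha, wordAvg_add, ih]

theorem wordAvg_map_not (L : ℕ) (φ : List Bool → ℝ) :
    wordAvg L (fun w => φ (w.map (!·))) = wordAvg L φ := by
  induction L generalizing φ with
  | zero => rfl
  | succ L ih =>
    have h1 := ih fun w => φ (true :: w)
    have h2 := ih fun w => φ (false :: w)
    simp only [wordAvg, List.map_cons, Bool.not_true, Bool.not_false]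
    rw [h1, h2, add_comm]

theorem sum_labels_cons {L : ℕ} (F : ZMod 2 → (Fin L → ZMod 2) → ℝ) :
    ∑ f : Fin (L + 1) → ZMod 2, F (f 0) (fun k => f k.succ) = ∑ f, (F 0 f + F 1 f) := by
  rw [← (Fin.consEquiv fun _ : Fin (L + 1) => ZMod 2).sum_comp, Fintype.sum_prod_type,
    Finset.sum_comm]
  refine Finset.sum_congr rfl fun f _ => ?_
  exact Fin.sum_univ_two fun x : Fin 2 => F x f

theorem sum_labels_ofFn (L : ℕ) (c : ℕ → ZMod 2) (φ : List Bool → ℝ) :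
    ∑ f : Fin (L + 1) → ZMod 2, φ (List.ofFn fun k : Fin L => decide (f k.castSucc = c k)) =
      2 ^ (L + 1) * wordAvg L φ := by
  induction L generalizing c φ with
  | zero => simp [wordAvg]
  | succ L ih =>
    have e : ∀ f : Fin (L + 1 + 1) → ZMod 2,
        φ (List.ofFn fun k : Fin (L + 1) => decide (f k.castSucc = c k)) =
          φ (decide (f 0 = c 0) ::
            List.ofFn fun k : Fin L => decide (f k.castSucc.succ = c (k + 1))) := by
      intro f
      rw [List.ofFn_succ]
      rfl
    refine (Finset.sum_congr rfl fun f _ => e f).trans ((sum_labels_cons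
      fun (x : ZMod 2) (g : Fin (L + 1) → ZMod 2) => φ (decide (x = c 0) ::
        List.ofFn fun k : Fin L => decide (g k.castSucc = c (k + 1)))).trans ?_)
    rw [Finset.sum_add_distrib]
    have hc : c 0 = 0 ∨ c 0 = 1 := by
      generalize c 0 = x
      revert x
      decide
    rw [ih (fun k => c (k + 1)) fun w => φ (decide (0 = c 0) :: w),
      ih (fun k => c (k + 1)) fun w => φ (decide (1 = c 0) :: w), wordAvg]
    rcases hc with hc | hc <;> simp [hc] <;> ring

theorem sum_wordOf (L : ℕ) (φ : List Bool → ℝ) :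
    ∑ f : Fin (L + 1 + 1) → ZMod 2, φ (wordOf L (extendLabels (L + 1) f)) =
      2 ^ (L + 2) * wordAvg L φ := by
  have e : ∀ f : Fin (L + 1 + 1) → ZMod 2, φ (wordOf L (extendLabels (L + 1) f)) =
      φ (List.ofFn fun k : Fin L => decide (f k.castSucc.succ = (((k : ℕ) + 1 : ℕ) : ZMod 2))) := by
    intro f
    simp only [wordOf]
    congr 2
    funext k
    have hk : (0 : ℤ) ≤ (k : ℕ) + 1 ∧ ((k : ℕ) + 1 : ℤ) ≤ (L + 1 : ℕ) := by omega
    rw [extendLabels, dif_pos hk]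
    push_cast
    rfl
  refine (Finset.sum_congr rfl fun f _ => e f).trans ((sum_labels_cons
    fun (_ : ZMod 2) (g : Fin (L + 1) → ZMod 2) => φ (List.ofFn fun k : Fin L =>
      decide (g k.castSucc = (((k : ℕ) + 1 : ℕ) : ZMod 2)))).trans ?_)
  rw [Finset.sum_add_distrib, sum_labels_ofFn L (fun k => ((k + 1 : ℕ) : ZMod 2))]
  ring

theorem IsExc.pos {X : ℤ → ℤ} {a b h : ℤ} (hE : IsExc X a b h) : 0 < h := by
  obtain ⟨i, h1, h2, h3⟩ := hE.2.2.2
  have := hE.2.2.1 i h1 h2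
  omega

theorem IsExc.unique {X : ℤ → ℤ} {a b b' h h' : ℤ} (hE : IsExc X a b h) (hE' : IsExc X a b' h') :
    b = b' ∧ h = h' := by
  have e : b = b' := by
    rcases lt_trichotomy b b' with hb | hb | hb
    · have := hE'.2.2.1 b hE.1 hb
      have := hE.2.1
      omega
    · exact hb
    · have := hE.2.2.1 b' hE'.1 hb
      have := hE'.2.1
      omega
  subst e
  obtain ⟨i, h1, h2, h3⟩ := hE.2.2.2
  obtain ⟨j, k1, k2, k3⟩ := hE'.2.2.2
  have := hE.2.2.1 j k1 k2
  have := hE'.2.2.1 i h1 h2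
  omega

theorem Exc.unique {X : ℤ → ℤ} {N a h h' : ℤ} (hE : Exc X N h a) (hE' : Exc X N h' a) : h = h' := by
  obtain ⟨b, -, hb⟩ := hE
  obtain ⟨b', -, hb'⟩ := hE'
  exact (hb.unique hb').2

theorem IsExc.height_lt {X : ℤ → ℤ} (hX : IsWalk X) {a b h : ℤ} (hE : IsExc X a b h) :
    h < b - a := by
  obtain ⟨i, h1, h2, h3⟩ := hE.2.2.2
  have : ∀ j, a ≤ j → X j ≤ X a + (j - a) := by
    intro j hj
    induction j, hj using Int.leInduction with
    | base => omega
    | succ l _ ih =>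
      have := hX l
      omega
  have := this i h1.le
  omega

theorem IsExc.congr_add {X X' : ℤ → ℤ} {N a b h c : ℤ} (ha : 0 ≤ a) (hb : b < N)
    (hX : ∀ i, 0 ≤ i → i < N → X' i = X i + c) (hE : IsExc X a b h) : IsExc X' a b h := by
  obtain ⟨h1, h2, h3, i, h4, h5, h6⟩ := hE
  have ea := hX a ha (by omega)
  refine ⟨h1, ?_, fun j j1 j2 => ?_, i, h4, h5, ?_⟩
  · rw [hX b (by omega) hb]
    omega
  · have := h3 j j1 j2
    rw [hX j (by omega) (by omega)]
    omega
  · rw [hX i (by omega) (by omega)]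
    omega

theorem exc_congr_add {X X' : ℤ → ℤ} {N a h c : ℤ} (ha : 0 ≤ a)
    (hX : ∀ i, 0 ≤ i → i < N → X' i = X i + c) : Exc X' N h a ↔ Exc X N h a := by
  constructor
  · rintro ⟨b, hb, hE⟩
    refine ⟨b, hb, hE.congr_add (c := -c) ha hb fun i h1 h2 => ?_⟩
    rw [hX i h1 h2]
    ring
  · rintro ⟨b, hb, hE⟩
    exact ⟨b, hb, hE.congr_add ha hb hX⟩

open Classical in
/-- The starting times of the excursions of height `h` of the walk with steps `w` that are finished
after at most `L` steps. -/
noncomputable def excStarts (L : ℕ) (h : ℤ) (w : List Bool) : Finset ℕ :=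
  {a ∈ Finset.range (L + 1) | Exc (walkOf w) (L + 1) h a}

theorem mem_excStarts {L : ℕ} {h : ℤ} {w : List Bool} {a : ℕ} :
    a ∈ excStarts L h w ↔ a < L + 1 ∧ Exc (walkOf w) (L + 1) h a := by
  classical
  simp [excStarts]

theorem walkOf_map_not {L : ℕ} {w : List Bool} (hw : w.length = L) {i : ℤ} (h0 : 0 ≤ i)
    (h1 : i < L + 1) : walkOf (w.map (!·)) i = -walkOf w i :=
  walkSum_map_not w (by omega)

theorem mem_excPairs_map_not {L M : ℕ} {u v : List Bool} (hu : u.length = L) (hv : v.length = M)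
    {q : ℕ × ℕ} :
    q ∈ excPairs (M + 1) (L + 1) (fun i => -walkOf (u.map (!·)) i)
        (fun j => -walkOf (v.map (!·)) j - 1) ↔
      (q.1 < L + 1 ∧ q.2 < M + 1) ∧ ∃ h, Exc (walkOf u) (L + 1) h q.1 ∧
        Exc (walkOf v) (M + 1) h q.2 ∧ (walkOf u q.1 + walkOf v q.2 + h) % 2 = 0 := by
  rw [mem_excPairs]
  refine and_congr_right fun hq => exists_congr fun h => ?_
  push_cast
  have e1 : ∀ i : ℤ, 0 ≤ i → i < L + 1 → -walkOf (u.map (!·)) i = walkOf u i + 0 :=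
    fun i h0 h1 => by rw [walkOf_map_not hu h0 h1]; ring
  have e2 : ∀ i : ℤ, 0 ≤ i → i < M + 1 → -walkOf (v.map (!·)) i - 1 = walkOf v i + -1 :=
    fun i h0 h1 => by rw [walkOf_map_not hv h0 h1]; ring
  rw [exc_congr_add (by omega) e1, exc_congr_add (by omega) e2, e1 _ (by omega) (by omega),
    e2 _ (by omega) (by omega)]
  refine and_congr_right fun _ => and_congr_right fun _ => ?_
  omega

theorem card_excPairs_add_card_excPairs {L M : ℕ} {u v : List Bool} (hu : u.length = L)
    (hv : v.length = M) :
    (excPairs (M + 1) (L + 1) (walkOf u) (walkOf v)).card +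
        (excPairs (M + 1) (L + 1) (fun i => -walkOf (u.map (!·)) i)
          (fun j => -walkOf (v.map (!·)) j - 1)).card =
      ∑ k ∈ Finset.range (L + 1), (excStarts L (k + 1) u).card * (excStarts M (k + 1) v).card := by
  classical
  have hdisj : Disjoint (excPairs (M + 1) (L + 1) (walkOf u) (walkOf v))
      (excPairs (M + 1) (L + 1) (fun i => -walkOf (u.map (!·)) i)
          (fun j => -walkOf (v.map (!·)) j - 1)) := by
    rw [Finset.disjoint_left]
    intro q h1 h2
    obtain ⟨-, h, hE, -, hp⟩ := mem_excPairs.1 h1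
    obtain ⟨-, h', hE', -, hp'⟩ := (mem_excPairs_map_not hu hv).1 h2
    push_cast at hE
    have := hE.unique hE'
    omega
  simp only [← Finset.card_product]
  rw [← Finset.card_union_of_disjoint hdisj, ← Finset.card_biUnion]
  · congr 1
    ext q
    simp only [Finset.mem_union, Finset.mem_biUnion, Finset.mem_product, mem_excPairs,
      mem_excPairs_map_not hu hv, mem_excStarts, Finset.mem_range]
    push_cast
    constructor
    · have key : ∀ h, q.1 < L + 1 → q.2 < M + 1 → Exc (walkOf u) (L + 1) h q.1 →
          Exc (walkOf v) (M + 1) h q.2 → ∃ a < L + 1,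
            (q.1 < L + 1 ∧ Exc (walkOf u) (L + 1) (a + 1) q.1) ∧
              q.2 < M + 1 ∧ Exc (walkOf v) (M + 1) (a + 1) q.2 := by
        intro h h1 h2 hE hE'
        have hb : 0 < h ∧ h < L + 1 := by
          obtain ⟨b, hb, hb'⟩ := hE
          have := hb'.pos
          have := hb'.height_lt (isWalk_walkOf u)
          omega
        have e : ((h.toNat - 1 : ℕ) : ℤ) + 1 = h := by omega
        refine ⟨h.toNat - 1, by omega, ?_⟩
        rw [e]
        exact ⟨⟨h1, hE⟩, h2, hE'⟩
      rintro (⟨⟨h1, h2⟩, h, hE, hE', -⟩ | ⟨⟨h1, h2⟩, h, hE, hE', -⟩)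
      · exact key h h1 h2 hE hE'
      · exact key h h1 h2 hE hE'
    · rintro ⟨a, ha, ⟨h1, hE⟩, h2, hE'⟩
      rcases Int.emod_two_eq_zero_or_one (walkOf u q.1 + walkOf v q.2 + (a + 1)) with hp | hp
      · exact Or.inr ⟨⟨h1, h2⟩, _, hE, hE', hp⟩
      · exact Or.inl ⟨⟨h1, h2⟩, _, hE, hE', hp⟩
  · intro k _ l _ hkl
    rw [Function.onFun, Finset.disjoint_left]
    intro q h1 h2
    have := (mem_excStarts.1 (Finset.mem_product.1 h1).1).2.unique
      (mem_excStarts.1 (Finset.mem_product.1 h2).1).2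
    omega

/-- The expected number of excursions of height `h` of the simple random walk with `L` steps. -/
noncomputable def excMean (L : ℕ) (h : ℤ) : ℝ := wordAvg L fun w => (excStarts L h w).card

theorem wordAvg_excPairsCount (L M : ℕ) :
    wordAvg L (fun u => wordAvg M fun v =>
        (excPairsCount (M + 1) (L + 1) (walkOf u) (walkOf v) : ℝ)) =
      ∑ k ∈ Finset.range (L + 1), excMean L (k + 1) * excMean M (k + 1) := by
  set Q : List Bool → List Bool → ℝ := fun u v => ((excPairs (M + 1) (L + 1)
    (fun i => -walkOf u i) (fun j => -walkOf v j - 1)).card : ℝ) with hQ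
  have hQ' : wordAvg L (fun u => wordAvg M fun v => Q u v) =
      wordAvg L fun u => wordAvg M fun v => Q (u.map (!·)) (v.map (!·)) := by
    rw [← wordAvg_map_not L]
    refine wordAvg_congr fun u _ => ?_
    rw [← wordAvg_map_not M]
  have h1 : wordAvg L (fun u => wordAvg M fun v =>
        (excPairsCount (M + 1) (L + 1) (walkOf u) (walkOf v) : ℝ)) =
      wordAvg L fun u => wordAvg M fun v =>
        ∑ k ∈ Finset.range (L + 1),
          ((excStarts L (k + 1) u).card : ℝ) * ((excStarts M (k + 1) v).card : ℝ) := by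
    simp only [excPairsCount, Nat.cast_add, wordAvg_add]
    rw [hQ', ← wordAvg_add]
    refine wordAvg_congr fun u hu => ?_
    rw [← wordAvg_add]
    refine wordAvg_congr fun v hv => ?_
    simp only [hQ]
    exact_mod_cast card_excPairs_add_card_excPairs hu hv
  rw [h1]
  simp only [wordAvg_sum, wordAvg_mul]
  refine Finset.sum_congr rfl fun k _ => ?_
  rw [excMean, mul_comm, ← wordAvg_mul]
  refine wordAvg_congr fun u _ => ?_
  rw [excMean, mul_comm]

theorem sum_sum_wordOf (L M : ℕ) (F : List Bool → List Bool → ℝ) :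
    ∑ f : Fin (L + 1 + 1) → ZMod 2, ∑ g : Fin (M + 1 + 1) → ZMod 2,
        F (wordOf L (extendLabels (L + 1) f)) (wordOf M (extendLabels (M + 1) g)) =
      2 ^ (M + 1 + (L + 1) + 2) * wordAvg L fun u => wordAvg M fun v => F u v := by
  rw [Finset.sum_congr rfl fun f _ => sum_wordOf M (F (wordOf L (extendLabels (L + 1) f))),
    ← Finset.mul_sum, sum_wordOf L fun u => wordAvg M (F u)]
  ring

theorem abs_eRegions_sub_le (L M : ℕ) :
    |ERegions (M + 1) (L + 1) - ∑ k ∈ Finset.range (L + 1), excMean L (k + 1) * excMean M (k + 1)| ≤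
      2 * ((M + 1 : ℕ) + (L + 1 : ℕ)) := by
  have hS := sum_sum_wordOf L M fun u v =>
    (excPairsCount (M + 1) (L + 1) (walkOf u) (walkOf v) : ℝ)
  have hS' := sum_sum_wordOf L M fun _ _ => (2 * ((M + 1 : ℕ) + (L + 1 : ℕ)) : ℝ)
  rw [wordAvg_excPairsCount] at hS
  simp only [wordAvg_const] at hS'
  have hpos : (0 : ℝ) < 2 ^ (M + 1 + (L + 1) + 2) := by positivity
  have hb := fun f g => regionsCount_bounds (m := M + 1) (n := L + 1) (by omega) (by omega)
    (extendLabels (L + 1) f) (extendLabels (M + 1) g)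
  simp only [Nat.add_sub_cancel] at hb
  have hlow : (2 : ℝ) ^ (M + 1 + (L + 1) + 2) *
      ∑ k ∈ Finset.range (L + 1), excMean L (k + 1) * excMean M (k + 1) ≤
      ∑ f : Fin (L + 1 + 1) → ZMod 2, ∑ g : Fin (M + 1 + 1) → ZMod 2,
        (RegionsCount (M + 1) (L + 1) (extendLabels (L + 1) f) (extendLabels (M + 1) g) : ℝ) := by
    rw [← hS]
    refine Finset.sum_le_sum fun f _ => Finset.sum_le_sum fun g _ => ?_
    exact_mod_cast (hb f g).1
  have hup : ∑ f : Fin (L + 1 + 1) → ZMod 2, ∑ g : Fin (M + 1 + 1) → ZMod 2,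
        (RegionsCount (M + 1) (L + 1) (extendLabels (L + 1) f) (extendLabels (M + 1) g) : ℝ) ≤
      2 ^ (M + 1 + (L + 1) + 2) *
        (∑ k ∈ Finset.range (L + 1), excMean L (k + 1) * excMean M (k + 1)) +
      2 ^ (M + 1 + (L + 1) + 2) * (2 * ((M + 1 : ℕ) + (L + 1 : ℕ))) := by
    rw [← hS, ← hS']
    simp only [← Finset.sum_add_distrib]
    refine Finset.sum_le_sum fun f _ => Finset.sum_le_sum fun g _ => ?_
    exact_mod_cast (hb f g).2
  rw [ERegions, abs_le]
  constructor
  · have : ∑ k ∈ Finset.range (L + 1), excMean L (k + 1) * excMean M (k + 1) ≤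
        (∑ f : Fin (L + 1 + 1) → ZMod 2, ∑ g : Fin (M + 1 + 1) → ZMod 2,
          (RegionsCount (M + 1) (L + 1) (extendLabels (L + 1) f) (extendLabels (M + 1) g) : ℝ)) /
          2 ^ (M + 1 + (L + 1) + 2) := by
      rw [le_div_iff₀ hpos]
      linarith
    have : (0 : ℝ) ≤ 2 * ((M + 1 : ℕ) + (L + 1 : ℕ)) := by positivity
    linarith
  · rw [sub_le_iff_le_add, div_le_iff₀ hpos]
    linarith

/-- The walk with steps `w` started at `x` visits `0` and stays in `(0, h]` before. -/
def Returns (h : ℤ) : ℤ → List Bool → Prop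
  | x, [] => x = 0
  | x, s :: w => x = 0 ∨ (0 < x ∧ x ≤ h) ∧ Returns h (x + stepVal s) w

theorem returns_iff {h x : ℤ} {w : List Bool} :
    Returns h x w ↔ ∃ l ≤ w.length, x + walkSum w l = 0 ∧
      ∀ l' < l, 0 < x + walkSum w l' ∧ x + walkSum w l' ≤ h := by
  induction w generalizing x with
  | nil =>
    simp [Returns, walkSum_zero]
  | cons s w ih =>
    rw [Returns, ih]
    constructor
    · rintro (rfl | ⟨hx, l, hl, h0, h1⟩)
      · exact ⟨0, by simp, by simp [walkSum_zero], by simp⟩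
      · refine ⟨l + 1, by simpa using hl, by rw [walkSum_cons]; omega, ?_⟩
        rintro (_ | l') hl'
        · simpa [walkSum_zero] using hx
        · have := h1 l' (by omega)
          rw [walkSum_cons]
          omega
    · rintro ⟨_ | l, hl, h0, h1⟩
      · simp only [walkSum_zero] at h0
        exact Or.inl (by omega)
      · have h2 := h1 0 (by omega)
        rw [walkSum_zero, add_zero] at h2
        rw [walkSum_cons] at h0
        refine Or.inr ⟨h2, l, by simpa using hl, by omega, fun l' hl' => ?_⟩
        have := h1 (l' + 1) (by omega)
        rw [walkSum_cons] at this
        omega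

theorem Returns.mono {h h' x : ℤ} {w : List Bool} (hh : h ≤ h') (hr : Returns h x w) :
    Returns h' x w := by
  rw [returns_iff] at *
  obtain ⟨l, h1, h2, h3⟩ := hr
  exact ⟨l, h1, h2, fun l' hl' => ⟨(h3 l' hl').1, (h3 l' hl').2.trans hh⟩⟩

theorem exc_cons_zero_iff (h : ℤ) (s : Bool) (w : List Bool) :
    Exc (walkOf (s :: w)) (w.length + 2) h 0 ↔ s = true ∧ Returns h 1 w ∧ ¬ Returns (h - 1) 1 w := by
  have hcons : ∀ k : ℕ, walkOf (s :: w) (k + 1) = stepVal s + walkSum w k := fun k => by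
    rw [← walkSum_cons, ← walkOf_natCast]
    push_cast
    rfl
  have h00 : walkOf (s :: w) 0 = 0 := rfl
  rw [returns_iff, returns_iff]
  constructor
  · rintro ⟨b, hb, hE⟩
    have hs : s = true := by
      have h1 := (hE.succ (isWalk_walkOf _)).2
      have h2 := hcons 0
      simp only [Nat.cast_zero, zero_add, walkSum_zero] at h1 h2
      cases s with
      | true => rfl
      | false => simp [stepVal] at h2; omega
    subst hs
    obtain ⟨h1, h2, h3, i, h4, h5, h6⟩ := hE
    rw [h00] at h2
    have hv : stepVal true = 1 := rfl
    rw [hv] at hcons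
    have eb := hcons (b - 1).toNat
    rw [show (((b - 1).toNat : ℤ) + 1) = b by omega] at eb
    have ei := hcons (i - 1).toNat
    rw [show (((i - 1).toNat : ℤ) + 1) = i by omega] at ei
    refine ⟨rfl, ⟨(b - 1).toNat, by omega, by omega, fun l hl => ?_⟩, ?_⟩
    · have := h3 (l + 1) (by omega) (by omega)
      rw [hcons, h00] at this
      omega
    · rintro ⟨l, k1, k2, k3⟩
      rcases le_or_gt l (i - 1).toNat with hl | hl
      · have := h3 (l + 1) (by omega) (by omega)
        rw [hcons, h00] at this
        omega
      · have := k3 _ hl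
        omega
  · rintro ⟨rfl, ⟨l, h1, h2, h3⟩, h4⟩
    have hv : stepVal true = 1 := rfl
    rw [hv] at hcons
    refine ⟨l + 1, by omega, by omega, ?_, fun i i0 i1 => ?_, ?_⟩
    · rw [hcons, h00, h2]
    · have ei := hcons (i - 1).toNat
      rw [show (((i - 1).toNat : ℤ) + 1) = i by omega] at ei
      have := h3 (i - 1).toNat (by omega)
      omega
    · by_contra hcon
      refine h4 ⟨l, h1, h2, fun l' hl' => ⟨(h3 l' hl').1, ?_⟩⟩
      have := (h3 l' hl').2
      by_contra hlt
      refine hcon ⟨l' + 1, by omega, by omega, ?_⟩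
      rw [hcons, h00]
      omega

theorem exc_add_one_iff {X : ℤ → ℤ} {N h a : ℤ} :
    Exc X (N + 1) h (a + 1) ↔ Exc (fun i => X (i + 1)) N h a := by
  constructor
  · rintro ⟨b, hb, h1, h2, h3, i, h4, h5, h6⟩
    refine ⟨b - 1, by omega, by omega, ?_, fun j j1 j2 => ?_, i - 1, by omega, by omega, ?_⟩
    · simpa using h2
    · exact h3 (j + 1) (by omega) (by omega)
    · simpa using h6
  · rintro ⟨b, hb, h1, h2, h3, i, h4, h5, h6⟩
    refine ⟨b + 1, by omega, by omega, h2, fun j j1 j2 => ?_, i + 1, by omega, by omega, h6⟩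
    have := h3 (j - 1) (by omega) (by omega)
    simpa using this

open Classical in
theorem card_excStarts_cons {L : ℕ} (h : ℤ) (s : Bool) {w : List Bool}
    (hw : w.length = L) :
    (excStarts (L + 1) h (s :: w)).card = (excStarts L h w).card +
      if s = true ∧ Returns h 1 w ∧ ¬ Returns (h - 1) 1 w then 1 else 0 := by
  rw [excStarts, excStarts, Finset.card_filter, Finset.card_filter, Finset.sum_range_succ']
  congr 1
  · refine Finset.sum_congr rfl fun a _ => if_congr ?_ rfl rfl
    push_cast
    rw [exc_add_one_iff]
    refine exc_congr_add (c := stepVal s) (by omega) fun i h0 _ => ?_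
    obtain ⟨k, rfl⟩ := Int.eq_ofNat_of_zero_le h0
    rw [walkOf_natCast, add_comm (walkSum w k), ← walkSum_cons, ← walkOf_natCast]
    push_cast
    rfl
  · refine if_congr ?_ rfl rfl
    rw [← exc_cons_zero_iff, hw]
    push_cast
    rw [add_assoc]
    rfl

open Classical in
/-- The probability that a simple random walk started at `x` visits `0` during the first `L` steps
and stays in `(0, h]` before. -/
noncomputable def retProb (h : ℤ) (L : ℕ) (x : ℤ) : ℝ :=
  wordAvg L fun w => if Returns h x w then 1 else 0

theorem retProb_zero (h x : ℤ) : retProb h 0 x = if x = 0 then 1 else 0 := by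
  classical
  rw [retProb, wordAvg]
  exact if_congr Iff.rfl rfl rfl

theorem retProb_succ (h : ℤ) (L : ℕ) (x : ℤ) : retProb h (L + 1) x =
    if x = 0 then 1 else if 0 < x ∧ x ≤ h then (retProb h L (x + 1) + retProb h L (x - 1)) / 2
    else 0 := by
  classical
  rw [retProb, wordAvg]
  by_cases h0 : x = 0
  · simp [Returns, h0, wordAvg_const]
  · by_cases h1 : 0 < x ∧ x ≤ h
    · have hs : ∀ s w, Returns h x (s :: w) ↔ Returns h (x + stepVal s) w := fun s w => by
        simp [Returns, h0, h1]
      rw [if_neg h0, if_pos h1, retProb, retProb]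
      congr 2
      · exact wordAvg_congr fun w _ => if_congr (hs true w) rfl rfl
      · exact wordAvg_congr fun w _ => if_congr (hs false w) rfl rfl
    · simp [Returns, h0, h1, wordAvg_const]

theorem excMean_zero (h : ℤ) : excMean 0 h = 0 := by
  classical
  simp only [excMean, wordAvg, Nat.cast_eq_zero, Finset.card_eq_zero,
    Finset.eq_empty_iff_forall_notMem, mem_excStarts]
  rintro a ⟨-, b, hb, hE⟩
  have := hE.1
  push_cast at hb
  omega

theorem excMean_succ (L : ℕ) (h : ℤ) :
    excMean (L + 1) h = excMean L h + (retProb h L 1 - retProb (h - 1) L 1) / 2 := by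
  classical
  have e1 : wordAvg L (fun w => ((excStarts (L + 1) h (false :: w)).card : ℝ)) = excMean L h :=
    wordAvg_congr fun w hw => by simp [card_excStarts_cons h false hw]
  have e2 : wordAvg L (fun w => ((excStarts (L + 1) h (true :: w)).card : ℝ)) + retProb (h - 1) L 1 =
      excMean L h + retProb h L 1 := by
    rw [retProb, excMean, retProb, ← wordAvg_add, ← wordAvg_add]
    refine wordAvg_congr fun w hw => ?_
    rw [card_excStarts_cons h true hw]
    have := fun hr : Returns (h - 1) 1 w => hr.mono (show h - 1 ≤ h by omega)
    by_cases h1 : Returns h 1 w <;> by_cases h2 : Returns (h - 1) 1 w <;> simp_all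
  rw [excMean, wordAvg, e1]
  linarith

theorem retProb_nonneg (h : ℤ) (L : ℕ) (x : ℤ) : 0 ≤ retProb h L x := by
  classical
  exact (wordAvg_const L 0).symm.trans_le
    (wordAvg_mono fun w => by split_ifs <;> norm_num)

theorem retProb_le_one (h : ℤ) (L : ℕ) (x : ℤ) : retProb h L x ≤ 1 := by
  classical
  exact (wordAvg_mono fun w => by split_ifs <;> norm_num).trans_eq (wordAvg_const L 1)

theorem retProb_eq_zero {h x : ℤ} (hx : ¬ (x = 0 ∨ (0 < x ∧ x ≤ h))) (L : ℕ) :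
    retProb h L x = 0 := by
  rw [not_or] at hx
  cases L with
  | zero => rw [retProb_zero, if_neg hx.1]
  | succ L => rw [retProb_succ, if_neg hx.1, if_neg hx.2]

theorem retProb_le_succ (h : ℤ) (L : ℕ) (x : ℤ) : retProb h L x ≤ retProb h (L + 1) x := by
  induction L generalizing x with
  | zero =>
    rw [retProb_zero]
    split_ifs with h0
    · rw [retProb_succ, if_pos h0]
    · exact retProb_nonneg _ _ _
  | succ L ih =>
    have h1 := ih (x + 1)
    have h2 := ih (x - 1)
    rw [retProb_succ, retProb_succ h (L + 1)]
    split_ifs <;> linarith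

theorem retProb_mono (L : ℕ) {h h' : ℤ} (hh : h ≤ h') (x : ℤ) : retProb h L x ≤ retProb h' L x := by
  classical
  refine wordAvg_mono fun w => ?_
  have := fun hr : Returns h x w => hr.mono hh
  by_cases h1 : Returns h x w <;> by_cases h2 : Returns h' x w <;> simp_all

theorem retProb_succ_sub_mono (L : ℕ) {h h' : ℤ} (hh : h ≤ h') (x : ℤ) :
    retProb h (L + 1) x - retProb h L x ≤ retProb h' (L + 1) x - retProb h' L x := by
  by_cases h1 : x = 0 ∨ (0 < x ∧ x ≤ h)
  · have h2 : x = 0 ∨ (0 < x ∧ x ≤ h') := h1.imp_right fun h => ⟨h.1, h.2.trans hh⟩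
    induction L generalizing x with
    | zero =>
      rw [retProb_succ, retProb_succ]
      simp only [retProb_zero]
      split_ifs <;> first | omega | linarith
    | succ L ih =>
      have ih' : ∀ y, retProb h (L + 1) y - retProb h L y ≤
          retProb h' (L + 1) y - retProb h' L y := by
        intro y
        by_cases hy : y = 0 ∨ (0 < y ∧ y ≤ h)
        · exact ih y hy (hy.imp_right fun h => ⟨h.1, h.2.trans hh⟩)
        · rw [retProb_eq_zero hy, retProb_eq_zero hy, sub_zero, sub_nonneg]
          exact retProb_le_succ _ _ _
      have h3 := ih' (x + 1)
      have h4 := ih' (x - 1)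
      rw [retProb_succ h (L + 1) x, retProb_succ h L x, retProb_succ h' (L + 1) x,
        retProb_succ h' L x]
      split_ifs <;> first | omega | linarith
  · rw [retProb_eq_zero h1, retProb_eq_zero h1, sub_zero, sub_nonneg]
    exact retProb_le_succ _ _ _

section Asymptotics

open Filter Topology

/-- Gambler's ruin. -/
theorem tendsto_retProb_one (h : ℕ) :
    Tendsto (fun L => retProb h L 1) atTop (𝓝 (1 - 1 / (h + 1))) := by
  have hlim : ∀ x, ∃ g, Tendsto (fun L => retProb h L x) atTop (𝓝 g) := fun x =>
    ⟨_, tendsto_atTop_ciSup (monotone_nat_of_le_succ fun L => retProb_le_succ h L x)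
      ⟨1, by rintro _ ⟨L, rfl⟩; exact retProb_le_one h L x⟩⟩
  choose g hg using hlim
  have hg0 : g 0 = 1 := by
    refine tendsto_nhds_unique ((tendsto_add_atTop_iff_nat 1).2 (hg 0)) ?_
    simp [retProb_succ]
  have hgh : g (h + 1) = 0 := by
    refine tendsto_nhds_unique ((tendsto_add_atTop_iff_nat 1).2 (hg (h + 1))) ?_
    have h1 : ¬ ((h : ℤ) + 1 = 0) := by omega
    simp [retProb_succ, h1]
  have hstep : ∀ x : ℤ, 0 < x → x ≤ h → g x = (g (x + 1) + g (x - 1)) / 2 := by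
    intro x h1 h2
    refine tendsto_nhds_unique ((tendsto_add_atTop_iff_nat 1).2 (hg x)) ?_
    simp only [retProb_succ, h1.ne', h1, h2, if_true, if_false, and_self]
    exact ((hg (x + 1)).add (hg (x - 1))).div_const 2
  have hlin : ∀ k : ℕ, k ≤ h → g k = 1 + k * (g 1 - 1) ∧ g (k + 1) = 1 + (k + 1) * (g 1 - 1) := by
    intro k
    induction k with
    | zero => intro _; simp [hg0]
    | succ k ih =>
      intro hk
      obtain ⟨h1, h2⟩ := ih (by omega)
      have h3 := hstep (k + 1) (by omega) (by omega)
      rw [add_sub_cancel_right, h1, h2] at h3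
      push_cast
      exact ⟨h2, by linarith⟩
  have h1 := (hlin h le_rfl).2
  rw [hgh] at h1
  have e : g 1 = 1 - 1 / (h + 1) := by
    field_simp
    linarith
  rw [← e]
  exact hg 1

/-- The density of the starting times of the excursions of height `k + 1`. -/
noncomputable def excDensity (k : ℕ) : ℝ := (1 / (k + 1) - 1 / (k + 2)) / 2

/-- The probability that a walk starts with an excursion of height `k + 1` that is finished after at
most `L + 1` steps. -/
noncomputable def excProb (k L : ℕ) : ℝ := (retProb (k + 1) L 1 - retProb k L 1) / 2

theorem excProb_nonneg (k L : ℕ) : 0 ≤ excProb k L := by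
  have := retProb_mono L (show (k : ℤ) ≤ k + 1 by omega) 1
  rw [excProb]
  linarith

theorem excProb_monotone (k : ℕ) : Monotone (excProb k) :=
  monotone_nat_of_le_succ fun L => by
    have := retProb_succ_sub_mono L (show (k : ℤ) ≤ k + 1 by omega) 1
    rw [excProb, excProb]
    linarith

theorem tendsto_excProb (k : ℕ) : Tendsto (excProb k) atTop (𝓝 (excDensity k)) := by
  have h := ((tendsto_retProb_one (k + 1)).sub (tendsto_retProb_one k)).div_const 2
  refine (h.congr fun L => ?_).trans_eq ?_
  · rw [excProb]
    push_cast
    rfl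
  · congr 1
    rw [excDensity]
    push_cast
    ring

theorem excMean_eq_sum (k L : ℕ) : excMean L (k + 1) = ∑ l ∈ Finset.range L, excProb k l := by
  induction L with
  | zero => exact excMean_zero _
  | succ L ih =>
    rw [Finset.sum_range_succ, ← ih, excMean_succ, excProb, add_sub_cancel_right]

theorem excDensity_nonneg (k : ℕ) : 0 ≤ excDensity k :=
  ge_of_tendsto' (tendsto_excProb k) (excProb_nonneg k)

theorem excMean_nonneg (k L : ℕ) : 0 ≤ excMean L (k + 1) := by
  rw [excMean_eq_sum]
  exact Finset.sum_nonneg fun l _ => excProb_nonneg k l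

theorem excMean_div_le (k L : ℕ) : excMean L (k + 1) / (L + 1) ≤ excDensity k := by
  have h := Finset.sum_le_card_nsmul (Finset.range L) (excProb k) (excDensity k) fun l _ =>
    (excProb_monotone k).ge_of_tendsto (tendsto_excProb k) l
  rw [Finset.card_range, nsmul_eq_mul] at h
  rw [div_le_iff₀ (by positivity), excMean_eq_sum]
  have := excDensity_nonneg k
  linarith

theorem tendsto_excMean_div (k : ℕ) :
    Tendsto (fun L : ℕ => excMean L (k + 1) / (L + 1)) atTop (𝓝 (excDensity k)) := by
  have h1 := (tendsto_excProb k).cesaro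
  have h2 := tendsto_natCast_div_add_atTop (1 : ℝ)
  have h := h1.mul h2
  rw [mul_one] at h
  refine h.congr fun L => ?_
  rw [← excMean_eq_sum]
  rcases Nat.eq_zero_or_pos L with rfl | hL
  · simp [excMean_zero]
  · have : (L : ℝ) ≠ 0 := by positivity
    field_simp

theorem hasSum_excDensity_sq :
    HasSum (fun k => excDensity k ^ 2) ((Real.pi ^ 2 - 9) / 12) := by
  have h1 : HasSum (fun k : ℕ => 1 / ((k : ℝ) + 1) ^ 2) (Real.pi ^ 2 / 6) := by
    have := (hasSum_nat_add_iff' 1).2 hasSum_zeta_two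
    simpa using this
  have h2 : HasSum (fun k : ℕ => 1 / ((k : ℝ) + 2) ^ 2) (Real.pi ^ 2 / 6 - 1) := by
    have := (hasSum_nat_add_iff' 2).2 hasSum_zeta_two
    simpa [Finset.sum_range_succ] using this
  have h3 : HasSum (fun k : ℕ => 1 / ((k : ℝ) + 1) - 1 / ((k : ℝ) + 2)) 1 := by
    rw [hasSum_iff_tendsto_nat_of_nonneg]
    · have e : ∀ n : ℕ, ∑ k ∈ Finset.range n, (1 / ((k : ℝ) + 1) - 1 / ((k : ℝ) + 2)) =
          1 - 1 / (n + 1) := by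
        intro n
        induction n with
        | zero => simp
        | succ n ih =>
          rw [Finset.sum_range_succ, ih]
          push_cast
          ring
      simp only [e]
      simpa using tendsto_one_div_add_atTop_nhds_zero_nat.const_sub (1 : ℝ)
    · intro k
      rw [sub_nonneg]
      exact one_div_le_one_div_of_le (by positivity) (by linarith)
  have h := ((h1.add h2).sub (h3.mul_left 2)).mul_left (1 / 4)
  have e : ∀ k : ℕ, 1 / 4 * (1 / ((k : ℝ) + 1) ^ 2 + 1 / ((k : ℝ) + 2) ^ 2 -
      2 * (1 / ((k : ℝ) + 1) - 1 / ((k : ℝ) + 2))) = excDensity k ^ 2 := by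
    intro k
    rw [excDensity]
    field_simp
    ring
  simp only [e] at h
  rwa [show (Real.pi ^ 2 - 9) / 12 =
    1 / 4 * (Real.pi ^ 2 / 6 + (Real.pi ^ 2 / 6 - 1) - 2 * 1) by ring]

theorem tendsto_sum_excMean :
    Tendsto (fun p : ℕ × ℕ => (∑ k ∈ Finset.range (p.1 + 1),
      excMean p.1 (k + 1) * excMean p.2 (k + 1)) / ((p.1 + 1) * (p.2 + 1)))
      (atTop ×ˢ atTop) (𝓝 ((Real.pi ^ 2 - 9) / 12)) := by
  rw [← hasSum_excDensity_sq.tsum_eq]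
  set F : ℕ × ℕ → ℕ → ℝ := fun p k => if k < p.1 + 1 then
    excMean p.1 (k + 1) / (p.1 + 1) * (excMean p.2 (k + 1) / (p.2 + 1)) else 0 with hF
  have hsum : ∀ p : ℕ × ℕ, ∑' k, F p k = (∑ k ∈ Finset.range (p.1 + 1),
      excMean p.1 (k + 1) * excMean p.2 (k + 1)) / ((p.1 + 1) * (p.2 + 1)) := by
    intro p
    rw [tsum_eq_sum (s := Finset.range (p.1 + 1)), Finset.sum_div]
    · refine Finset.sum_congr rfl fun k hk => ?_
      rw [hF]
      simp only
      rw [if_pos (Finset.mem_range.1 hk), div_mul_div_comm]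
    · intro k hk
      exact if_neg fun h => hk (Finset.mem_range.2 h)
  simp only [← hsum]
  refine tendsto_tsum_of_dominated_convergence hasSum_excDensity_sq.summable (fun k => ?_)
    (.of_forall fun p k => ?_)
  · have h := ((tendsto_excMean_div k).comp tendsto_fst).mul
      ((tendsto_excMean_div k).comp (tendsto_snd (f := (atTop : Filter ℕ)) (g := (atTop : Filter ℕ))))
    rw [sq]
    refine h.congr' ?_
    filter_upwards [tendsto_fst.eventually (eventually_ge_atTop k)] with p hp
    exact (if_pos (by omega)).symm
  · have h1 : 0 ≤ excMean p.1 (k + 1) / (p.1 + 1) :=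
      div_nonneg (excMean_nonneg _ _) (by positivity)
    have h2 : 0 ≤ excMean p.2 (k + 1) / (p.2 + 1) :=
      div_nonneg (excMean_nonneg _ _) (by positivity)
    simp only [hF]
    split_ifs
    · rw [Real.norm_of_nonneg (mul_nonneg h1 h2), sq]
      exact mul_le_mul (excMean_div_le _ _) (excMean_div_le _ _) h2 (excDensity_nonneg k)
    · rw [norm_zero]
      positivity

end Asymptotics

/-- As `min {m, n} → ∞`, the expected number of regions of the random
`m × n` hitomezashi pattern satisfies
`E[Regions(H_{1/2}(m,n))] = ((π² − 9)/12 + o(1)) · m · n`. -/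
theorem hitomezashi_expected_regions :
    ∀ δ : ℝ, 0 < δ → ∃ N : ℕ, ∀ m n : ℕ, N ≤ m → N ≤ n →
      |ERegions m n - ((Real.pi ^ 2 - 9) / 12) * (m * n)| ≤ δ * (m * n) := by
  intro δ hδ
  obtain ⟨N, hN⟩ := (Filter.prod_atTop_atTop_eq (α := ℕ) (β := ℕ) ▸ Metric.tendsto_nhds.1
    tendsto_sum_excMean (δ / 2) (by positivity)).exists_forall_of_atTop
  obtain ⟨K, hK⟩ := exists_nat_gt (8 / δ)
  refine ⟨N.1 + N.2 + K + 1, fun m n hm hn => ?_⟩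
  obtain ⟨M, rfl⟩ : ∃ M, m = M + 1 := ⟨m - 1, by omega⟩
  obtain ⟨L, rfl⟩ : ∃ L, n = L + 1 := ⟨n - 1, by omega⟩
  have h1 := hN (L, M) ⟨by simp only; omega, by simp only; omega⟩
  have h2 := abs_eRegions_sub_le L M
  set S := ∑ k ∈ Finset.range (L + 1), excMean L (k + 1) * excMean M (k + 1) with hS
  have hMK : (8 / δ : ℝ) ≤ (M + 1 : ℕ) := hK.le.trans (by exact_mod_cast (by omega))
  have hLK : (8 / δ : ℝ) ≤ (L + 1 : ℕ) := hK.le.trans (by exact_mod_cast (by omega))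
  rw [div_le_iff₀ hδ] at hMK hLK
  push_cast at *
  have hM : (0 : ℝ) < M + 1 := by positivity
  have hL : (0 : ℝ) < L + 1 := by positivity
  set x : ℝ := M + 1
  set y : ℝ := L + 1
  have h3 : |S - (Real.pi ^ 2 - 9) / 12 * (x * y)| ≤ δ / 2 * (x * y) := by
    have hxy : 0 < y * x := mul_pos hL hM
    have e : S - (Real.pi ^ 2 - 9) / 12 * (x * y) =
        (S / (y * x) - (Real.pi ^ 2 - 9) / 12) * (y * x) := by
      field_simp
    rw [e, abs_mul, abs_of_pos hxy, mul_comm x y]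
    rw [Real.dist_eq] at h1
    exact mul_le_mul_of_nonneg_right h1.le hxy.le
  have h4 : 2 * (x + y) ≤ δ / 2 * (x * y) := by nlinarith
  calc _ = |(ERegions (M + 1) (L + 1) - S) + (S - (Real.pi ^ 2 - 9) / 12 * (x * y))| := by ring_nf
    _ ≤ _ := abs_add_le _ _
    _ ≤ _ := by linarith
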